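/- arXiv:2502.02064 — 6 statements merged into one kernel-verified Lean document; each statement's English description precedes it below -/
import Mathlib

section
/- Let c ∈ (0,∞) and let ψ : ℕ → ℝ⁺ be defined by ψ(n) = e^{c⌊√n⌋}. Suppose θ₀ ∈ (1/2, 1) is such that the limit P(θ₀) = lim_{n→∞} (1/n)·log Σ_{(a_1,…,a_n)∈ℕⁿ} q_n(a_1,…,a_n)^{−2θ₀} exists and satisfies P(θ₀) = c·(θ₀ − 1/2). Then the Hausdorff dimension of L(ψ) equals θ₀. -/
open Filter Set
open scoped ENNReal

/-- The Gauss map. -/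
noncomputable def gaussMap (x : ℝ) : ℝ := Int.fract (1 / x)

/-- The `n`-th partial quotient `a_n(x)` (for `n ≥ 1`) of the continued fraction
expansion of `x ∈ (0,1)`. -/
noncomputable def pq (x : ℝ) (n : ℕ) : ℕ := ⌊1 / (gaussMap^[n - 1] x)⌋₊

/-- `L_n(x) = max_{1 ≤ i ≤ n} a_i(x) a_{i+1}(x)`. -/
noncomputable def Lmax (x : ℝ) (n : ℕ) : ℕ :=
  (Finset.Icc 1 n).sup fun i => pq x i * pq x (i + 1)

/-- The level set `L(φ)` of irrational `x ∈ (0,1)` with `L_n(x)/φ(n) → 1`. -/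
def Lset (φ : ℕ → ℝ) : Set ℝ :=
  {x | x ∈ Ioo (0 : ℝ) 1 ∧ Irrational x ∧
    Tendsto (fun n => (Lmax x n : ℝ) / φ n) atTop (nhds 1)}

/-- `f` is regularly increasing with (finite) index `ρ`. -/
def RegInc (f : ℝ → ℝ) (ρ : ℝ) : Prop :=
  ∃ c > (0 : ℝ), ∃ f' : ℝ → ℝ,
    (∀ x ∈ Ici c, 0 < f x) ∧
    (∀ x ∈ Ici c, HasDerivAt f (f' x) x) ∧
    ContinuousOn f' (Ici c) ∧
    (∀ x ∈ Ici c, 0 < f' x) ∧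
    Tendsto f atTop atTop ∧
    Tendsto (fun x => x * f' x / f x) atTop (nhds ρ)

/-- `f` is regularly increasing with index `∞`. -/
def RegIncTop (f : ℝ → ℝ) : Prop :=
  ∃ c > (0 : ℝ), ∃ f' : ℝ → ℝ,
    (∀ x ∈ Ici c, 0 < f x) ∧
    (∀ x ∈ Ici c, HasDerivAt f (f' x) x) ∧
    ContinuousOn f' (Ici c) ∧
    (∀ x ∈ Ici c, 0 < f' x) ∧
    Tendsto f atTop atTop ∧
    Tendsto (fun x => x * f' x / f x) atTop atTop

/-- The continuant `q_n(a_1, …, a_n)`: the denominator of the finite continued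
fraction `[a_1, …, a_n]`, satisfying `q_k = a_k q_{k-1} + q_{k-2}`. -/
def contDen : List ℕ → ℕ
  | [] => 1
  | [a] => a
  | a :: b :: l => a * contDen (b :: l) + contDen l

/-! ### Finite continued fractions with a real tail -/

/-- The value of the finite continued fraction `[a₁, …, aₙ + t]`. -/
noncomputable def cfVal (t : ℝ) : List ℕ → ℝ
  | [] => t
  | a :: w => 1 / (a + cfVal t w)

/-- The denominator `qₙ + t qₙ₋₁` of `[a₁, …, aₙ + t]`. -/
noncomputable def cfDen (t : ℝ) : List ℕ → ℝ
  | [] => 1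
  | a :: w => (a + cfVal t w) * cfDen t w

/-- All entries of a word are positive. -/
def PosWord (w : List ℕ) : Prop := ∀ a ∈ w, 1 ≤ a

lemma PosWord.nil : PosWord [] := by simp [PosWord]

lemma posWord_cons {a : ℕ} {w : List ℕ} : PosWord (a :: w) ↔ 1 ≤ a ∧ PosWord w := by
  simp [PosWord]

lemma posWord_append {u v : List ℕ} : PosWord (u ++ v) ↔ PosWord u ∧ PosWord v := by
  simp only [PosWord, List.mem_append]
  exact ⟨fun h => ⟨fun a ha => h a (.inl ha), fun a ha => h a (.inr ha)⟩,
    fun h a ha => ha.elim (h.1 a) (h.2 a)⟩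

lemma posWord_replicate_one (n : ℕ) : PosWord (List.replicate n 1) := by
  intro a ha
  rw [List.eq_of_mem_replicate ha]

lemma cfVal_mem_Icc {t : ℝ} (ht : t ∈ Icc (0 : ℝ) 1) {w : List ℕ} (hw : PosWord w) :
    cfVal t w ∈ Icc (0 : ℝ) 1 := by
  induction w with
  | nil => exact ht
  | cons a w ih =>
    rw [posWord_cons] at hw
    have h := ih hw.2
    have ha : (1 : ℝ) ≤ a := by exact_mod_cast hw.1
    have h1 : (1 : ℝ) ≤ a + cfVal t w := by linarith [h.1]
    exact ⟨by simp only [cfVal]; positivity, by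
      simp only [cfVal]; rw [div_le_one (by linarith)]; exact h1⟩

lemma cfDen_one_le {t : ℝ} (ht : t ∈ Icc (0 : ℝ) 1) {w : List ℕ} (hw : PosWord w) :
    1 ≤ cfDen t w := by
  induction w with
  | nil => simp [cfDen]
  | cons a w ih =>
    rw [posWord_cons] at hw
    have h := ih hw.2
    have h0 := cfVal_mem_Icc ht hw.2
    have ha : (1 : ℝ) ≤ a := by exact_mod_cast hw.1
    have h1 : (1 : ℝ) ≤ a + cfVal t w := by linarith [h0.1]
    simp only [cfDen]
    nlinarith

lemma cfVal_append (t : ℝ) (u v : List ℕ) : cfVal t (u ++ v) = cfVal (cfVal t v) u := by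
  induction u with
  | nil => rfl
  | cons a u ih => simp [cfVal, ih]

lemma cfDen_append (t : ℝ) (u v : List ℕ) :
    cfDen t (u ++ v) = cfDen (cfVal t v) u * cfDen t v := by
  induction u with
  | nil => simp [cfDen]
  | cons a u ih => simp [cfDen, ih, cfVal_append, mul_assoc]

lemma cfVal_mul_cfDen_cons {t : ℝ} (ht : t ∈ Icc (0 : ℝ) 1) {a : ℕ} {w : List ℕ}
    (hw : PosWord (a :: w)) : cfVal t (a :: w) * cfDen t (a :: w) = cfDen t w := by
  rw [posWord_cons] at hw
  have h0 := cfVal_mem_Icc ht hw.2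
  have ha : (1 : ℝ) ≤ a := by exact_mod_cast hw.1
  have h1 : (a : ℝ) + cfVal t w ≠ 0 := by linarith [h0.1]
  simp only [cfDen, cfVal]
  field_simp

lemma cfDen_cons (t : ℝ) (a : ℕ) (w : List ℕ) :
    cfDen t (a :: w) = a * cfDen t w + cfVal t w * cfDen t w := by
  simp only [cfDen]; ring

lemma cfDen_zero_le_aux {t : ℝ} (ht : t ∈ Icc (0 : ℝ) 1) {w : List ℕ} (hw : PosWord w) :
    cfDen 0 w ≤ cfDen t w ∧ cfVal 0 w * cfDen 0 w ≤ cfVal t w * cfDen t w := by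
  induction w with
  | nil => simpa [cfDen, cfVal] using ht.1
  | cons a w ih =>
    have hw' := (posWord_cons.1 hw).2
    have h := ih hw'
    rw [cfVal_mul_cfDen_cons ht hw, cfVal_mul_cfDen_cons ⟨le_rfl, zero_le_one⟩ hw, cfDen_cons,
      cfDen_cons]
    refine ⟨?_, h.1⟩
    have := mul_le_mul_of_nonneg_left h.1 (Nat.cast_nonneg (α := ℝ) a)
    linarith [h.2]

lemma cfDen_zero_le {t : ℝ} (ht : t ∈ Icc (0 : ℝ) 1) {w : List ℕ} (hw : PosWord w) :
    cfDen 0 w ≤ cfDen t w := (cfDen_zero_le_aux ht hw).1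

lemma cfDen_le_two_mul_aux {t : ℝ} (ht : t ∈ Icc (0 : ℝ) 1) {a : ℕ} {w : List ℕ}
    (hw : PosWord (a :: w)) :
    cfDen t (a :: w) ≤ 2 * cfDen 0 (a :: w) ∧ cfDen t w ≤ 2 * cfDen 0 w := by
  induction w generalizing a with
  | nil =>
    have ha : (1 : ℝ) ≤ a := by exact_mod_cast (posWord_cons.1 hw).1
    simp only [cfDen, cfVal]
    constructor <;> linarith [ht.2]
  | cons b w ih =>
    have hw' := (posWord_cons.1 hw).2
    have h := ih hw'
    refine ⟨?_, h.1⟩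
    rw [cfDen_cons t a, cfDen_cons 0 a, cfVal_mul_cfDen_cons ht hw',
      cfVal_mul_cfDen_cons ⟨le_rfl, zero_le_one⟩ hw']
    have := mul_le_mul_of_nonneg_left h.1 (Nat.cast_nonneg (α := ℝ) a)
    linarith [h.2]

lemma cfDen_le_two_mul {t : ℝ} (ht : t ∈ Icc (0 : ℝ) 1) {w : List ℕ} (hw : PosWord w) :
    cfDen t w ≤ 2 * cfDen 0 w := by
  cases w with
  | nil => simp [cfDen]
  | cons a w => exact (cfDen_le_two_mul_aux ht hw).1

lemma contDen_eq_cfDen {w : List ℕ} (hw : PosWord w) : (contDen w : ℝ) = cfDen 0 w := by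
  induction w using contDen.induct with
  | case1 => simp [contDen, cfDen]
  | case2 a => simp [contDen, cfDen, cfVal]
  | case3 a b l ih1 ih2 =>
    have hb := (posWord_cons.1 hw).2
    rw [contDen, cfDen_cons, cfVal_mul_cfDen_cons ⟨le_rfl, zero_le_one⟩ hb]
    push_cast
    rw [ih1 hb, ih2 (posWord_cons.1 hb).2]

lemma one_le_contDen {w : List ℕ} (hw : PosWord w) : (1 : ℝ) ≤ contDen w := by
  rw [contDen_eq_cfDen hw]
  exact cfDen_one_le ⟨le_rfl, zero_le_one⟩ hw

lemma contDen_mul_le {u v : List ℕ} (hu : PosWord u) (hv : PosWord v) :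
    (contDen u : ℝ) * contDen v ≤ contDen (u ++ v) := by
  have h0 : (0 : ℝ) ∈ Icc (0 : ℝ) 1 := ⟨le_rfl, zero_le_one⟩
  rw [contDen_eq_cfDen hu, contDen_eq_cfDen hv, contDen_eq_cfDen (posWord_append.2 ⟨hu, hv⟩),
    cfDen_append]
  have := cfDen_one_le h0 hv
  exact mul_le_mul_of_nonneg_right (cfDen_zero_le (cfVal_mem_Icc h0 hv) hu) (by linarith)

lemma contDen_append_le {u v : List ℕ} (hu : PosWord u) (hv : PosWord v) :
    (contDen (u ++ v) : ℝ) ≤ 2 * (contDen u * contDen v) := by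
  have h0 : (0 : ℝ) ∈ Icc (0 : ℝ) 1 := ⟨le_rfl, zero_le_one⟩
  rw [contDen_eq_cfDen hu, contDen_eq_cfDen hv, contDen_eq_cfDen (posWord_append.2 ⟨hu, hv⟩),
    cfDen_append, ← mul_assoc]
  have := cfDen_one_le h0 hv
  exact mul_le_mul_of_nonneg_right (cfDen_le_two_mul (cfVal_mem_Icc h0 hv) hu) (by linarith)

lemma abs_cfVal_sub {s t : ℝ} (hs : s ∈ Icc (0 : ℝ) 1) (ht : t ∈ Icc (0 : ℝ) 1) {w : List ℕ}
    (hw : PosWord w) : |cfVal s w - cfVal t w| = |s - t| / (cfDen s w * cfDen t w) := by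
  induction w with
  | nil => simp [cfVal, cfDen]
  | cons a w ih =>
    have hw' := (posWord_cons.1 hw).2
    have ha : (1 : ℝ) ≤ a := by exact_mod_cast (posWord_cons.1 hw).1
    have hs1 := cfVal_mem_Icc hs hw'
    have ht1 := cfVal_mem_Icc ht hw'
    have hs0 : 0 < a + cfVal s w := by linarith [hs1.1]
    have ht0 : 0 < a + cfVal t w := by linarith [ht1.1]
    have hsd := cfDen_one_le hs hw'
    have htd := cfDen_one_le ht hw'
    simp only [cfVal, cfDen]
    rw [div_sub_div _ _ hs0.ne' ht0.ne', abs_div, abs_of_pos (mul_pos hs0 ht0),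
      show 1 * (a + cfVal t w) - (a + cfVal s w) * 1 = -(cfVal s w - cfVal t w) by ring, abs_neg,
      ih hw', div_div]
    congr 1
    ring

lemma abs_cfVal_sub_le {s t : ℝ} (hs : s ∈ Icc (0 : ℝ) 1) (ht : t ∈ Icc (0 : ℝ) 1) {w : List ℕ}
    (hw : PosWord w) : |cfVal s w - cfVal t w| ≤ 1 / (contDen w : ℝ) ^ 2 := by
  rw [abs_cfVal_sub hs ht hw, contDen_eq_cfDen hw]
  have h0 := cfDen_one_le ⟨le_rfl, zero_le_one⟩ hw
  have h1 := cfDen_zero_le hs hw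
  have h2 := cfDen_zero_le ht hw
  have h3 : |s - t| ≤ 1 := by
    rw [abs_le]; constructor <;> linarith [hs.1, hs.2, ht.1, ht.2]
  have h4 : cfDen 0 w ^ 2 ≤ cfDen s w * cfDen t w := by
    rw [sq]
    exact mul_le_mul h1 h2 (by linarith) (by linarith)
  have h5 : 0 < cfDen 0 w ^ 2 := by positivity
  exact div_le_div₀ zero_le_one h3 h5 h4

lemma le_abs_cfVal_sub {s t : ℝ} (hs : s ∈ Icc (0 : ℝ) 1) (ht : t ∈ Icc (0 : ℝ) 1) {w : List ℕ}
    (hw : PosWord w) : |s - t| / (4 * (contDen w : ℝ) ^ 2) ≤ |cfVal s w - cfVal t w| := by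
  rw [abs_cfVal_sub hs ht hw, contDen_eq_cfDen hw]
  have h0 := cfDen_one_le ⟨le_rfl, zero_le_one⟩ hw
  have h1 := cfDen_le_two_mul hs hw
  have h2 := cfDen_le_two_mul ht hw
  have h3 := cfDen_one_le hs hw
  have h4 := cfDen_one_le ht hw
  have h5 : cfDen s w * cfDen t w ≤ 4 * cfDen 0 w ^ 2 := by
    calc cfDen s w * cfDen t w ≤ (2 * cfDen 0 w) * (2 * cfDen 0 w) :=
          mul_le_mul h1 h2 (by linarith) (by linarith)
      _ = 4 * cfDen 0 w ^ 2 := by ring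
  exact div_le_div_of_nonneg_left (abs_nonneg _) (by positivity) h5

/-- The crude upper bound `∏ (aᵢ + 1)` for the continuant. -/
def wordSize (w : List ℕ) : ℕ := (w.map (· + 1)).prod

lemma wordSize_cons (a : ℕ) (w : List ℕ) : wordSize (a :: w) = (a + 1) * wordSize w := by
  simp [wordSize]

lemma one_le_wordSize (w : List ℕ) : 1 ≤ wordSize w := by
  induction w with
  | nil => simp [wordSize]
  | cons a w ih => rw [wordSize_cons]; exact Nat.one_le_iff_ne_zero.2 (by positivity)

lemma contDen_le_wordSize {w : List ℕ} (hw : PosWord w) : (contDen w : ℝ) ≤ wordSize w := by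
  rw [contDen_eq_cfDen hw]
  induction w with
  | nil => simp [cfDen, wordSize]
  | cons a w ih =>
    have hw' := (posWord_cons.1 hw).2
    have h0 : (0 : ℝ) ∈ Icc (0 : ℝ) 1 := ⟨le_rfl, zero_le_one⟩
    have h1 := cfVal_mem_Icc h0 hw'
    rw [wordSize_cons]
    push_cast
    simp only [cfDen]
    have := cfDen_one_le h0 hw'
    gcongr
    · exact h1.2
    · exact ih hw'

lemma one_div_wordSize_le_cfVal {t : ℝ} (ht : t ∈ Icc (0 : ℝ) 1) {w : List ℕ} (hw : PosWord w)
    (hne : w ≠ []) : 1 / (wordSize w : ℝ) ≤ cfVal t w := by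
  cases w with
  | nil => exact absurd rfl hne
  | cons a w =>
    have hw' := (posWord_cons.1 hw).2
    have h1 := cfVal_mem_Icc ht hw'
    have ha : (1 : ℝ) ≤ a := by exact_mod_cast (posWord_cons.1 hw).1
    have h2 : (1 : ℝ) ≤ wordSize w := by exact_mod_cast one_le_wordSize w
    rw [wordSize_cons]
    simp only [cfVal]
    push_cast
    have : 0 < (a : ℝ) + cfVal t w := by linarith [h1.1]
    gcongr
    nlinarith [h1.2]

lemma sub_ge_of_head_lt {s t : ℝ} (hs : s ∈ Icc (0 : ℝ) 1) (ht : t ∈ Icc (0 : ℝ) 1)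
    {a b : ℕ} {u v : List ℕ} (hu : PosWord (a :: u)) (hv : PosWord (b :: v)) (hne : v ≠ [])
    (hab : a < b) :
    1 / ((wordSize (a :: u) : ℝ) * wordSize (b :: v)) ≤ cfVal s (a :: u) - cfVal t (b :: v) := by
  have hu' := (posWord_cons.1 hu).2
  have hv' := (posWord_cons.1 hv).2
  have ha : (1 : ℝ) ≤ a := by exact_mod_cast (posWord_cons.1 hu).1
  have hb : (1 : ℝ) ≤ b := by exact_mod_cast (posWord_cons.1 hv).1
  have hab' : (a : ℝ) + 1 ≤ b := by exact_mod_cast hab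
  have h1 := cfVal_mem_Icc hs hu'
  have h2 := cfVal_mem_Icc ht hv'
  have h3 := one_div_wordSize_le_cfVal ht hv' hne
  have hU : (1 : ℝ) ≤ wordSize u := by exact_mod_cast one_le_wordSize u
  have hV : (1 : ℝ) ≤ wordSize v := by exact_mod_cast one_le_wordSize v
  rw [wordSize_cons, wordSize_cons]
  simp only [cfVal]
  push_cast
  set x := cfVal s u
  set y := cfVal t v
  have hx : 0 < (a : ℝ) + x := by linarith [h1.1]
  have hy : 0 < (b : ℝ) + y := by linarith [h2.1]
  rw [div_sub_div _ _ hx.ne' hy.ne']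
  have h5 : 1 / (wordSize v : ℝ) ≤ 1 * (b + y) - (a + x) * 1 := by linarith [h1.2]
  have hvpos : 0 < 1 / (wordSize v : ℝ) := by positivity
  calc 1 / ((a + 1 : ℝ) * wordSize u * ((b + 1) * wordSize v))
      ≤ 1 / ((a + 1 : ℝ) * 1 * ((b + 1) * wordSize v)) := by gcongr
    _ = (1 / (wordSize v : ℝ)) / ((a + 1) * (b + 1)) := by field_simp
    _ ≤ (1 * (b + y) - (a + x) * 1) / ((a + x) * (b + y)) := by
      gcongr
      · linarith
      · exact h1.2
      · exact h2.2

lemma separation {s t : ℝ} (hs : s ∈ Icc (0 : ℝ) 1) (ht : t ∈ Icc (0 : ℝ) 1) {u v e : List ℕ}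
    (hlen : u.length = v.length) (huv : u ≠ v) (he : e ≠ []) (hu : PosWord (u ++ e))
    (hv : PosWord (v ++ e)) :
    1 / ((wordSize (u ++ e) : ℝ) * wordSize (v ++ e)) ≤
      |cfVal s (u ++ e) - cfVal t (v ++ e)| := by
  induction u generalizing v with
  | nil =>
    cases v with
    | nil => exact absurd rfl huv
    | cons b v => simp at hlen
  | cons a u ih =>
    cases v with
    | nil => simp at hlen
    | cons b v =>
      rw [List.cons_append] at hu hv ⊢
      rw [List.cons_append]
      rcases lt_trichotomy a b with hab | hab | hab
      · exact (sub_ge_of_head_lt hs ht hu hv (by simp [he]) hab).trans (le_abs_self _)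
      · subst hab
        have hu' := (posWord_cons.1 hu).2
        have hv' := (posWord_cons.1 hv).2
        have ha : (1 : ℝ) ≤ a := by exact_mod_cast (posWord_cons.1 hu).1
        have h := ih (v := v) (by simpa using hlen) (by simpa using huv) hu' hv'
        have h1 := cfVal_mem_Icc hs hu'
        have h2 := cfVal_mem_Icc ht hv'
        rw [wordSize_cons, wordSize_cons]
        simp only [cfVal]
        push_cast
        set x := cfVal s (u ++ e)
        set y := cfVal t (v ++ e)
        have hx : 0 < (a : ℝ) + x := by linarith [h1.1]
        have hy : 0 < (a : ℝ) + y := by linarith [h2.1]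
        rw [div_sub_div _ _ hx.ne' hy.ne', abs_div, abs_of_pos (mul_pos hx hy),
          show 1 * (a + y) - (a + x) * 1 = -(x - y) by ring, abs_neg]
        calc 1 / ((a + 1 : ℝ) * wordSize (u ++ e) * ((a + 1) * wordSize (v ++ e)))
            = (1 / ((wordSize (u ++ e) : ℝ) * wordSize (v ++ e))) / ((a + 1) * (a + 1)) := by
              rw [div_div]; congr 1; ring
          _ ≤ |x - y| / ((a + x) * (a + y)) := by
            gcongr
            · exact h1.2
            · exact h2.2
      · rw [mul_comm, abs_sub_comm]
        exact (sub_ge_of_head_lt ht hs hv hu (by simp [he]) hab).trans (le_abs_self _)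

/-! ### Partial quotients and the Gauss map -/

/-- The word of the first `n` partial quotients of `x`. -/
noncomputable def digits (x : ℝ) (n : ℕ) : List ℕ := (List.range n).map fun i => pq x (i + 1)

lemma gaussMap_spec {x : ℝ} (hx : x ∈ Ioo (0 : ℝ) 1) (hirr : Irrational x) :
    gaussMap x ∈ Ioo (0 : ℝ) 1 ∧ Irrational (gaussMap x) ∧ 1 ≤ pq x 1 ∧
      x = 1 / (pq x 1 + gaussMap x) := by
  have hinv : Irrational (1 / x) := by simpa using hirr.inv
  have hirr' : Irrational (gaussMap x) := by
    unfold gaussMap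
    rw [← Int.self_sub_floor]
    exact hinv.sub_intCast _
  have h1 : 1 < 1 / x := by rw [lt_div_iff₀ hx.1]; linarith [hx.2]
  refine ⟨⟨lt_of_le_of_ne (Int.fract_nonneg _) ?_, Int.fract_lt_one _⟩, hirr', ?_, ?_⟩
  · intro h
    exact hirr'.ne_zero h.symm
  · simp only [pq]
    rw [Nat.one_le_floor_iff]
    exact h1.le
  · have h2 : (pq x 1 : ℝ) + gaussMap x = 1 / x := by
      simp only [pq, gaussMap, Nat.sub_self, Function.iterate_zero, id]
      rw [natCast_floor_eq_intCast_floor (by linarith)]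
      exact Int.floor_add_fract _
    rw [h2, one_div_one_div]

lemma pq_gaussMap (x : ℝ) (i : ℕ) : pq (gaussMap x) (i + 1) = pq x (i + 2) := by
  simp [pq, Function.iterate_succ_apply]

lemma digits_succ (x : ℝ) (n : ℕ) : digits x (n + 1) = pq x 1 :: digits (gaussMap x) n := by
  simp [digits, List.range_succ_eq_map, Function.comp_def, pq_gaussMap]

lemma gaussMap_iterate_spec {x : ℝ} (hx : x ∈ Ioo (0 : ℝ) 1) (hirr : Irrational x) (n : ℕ) :
    gaussMap^[n] x ∈ Ioo (0 : ℝ) 1 ∧ PosWord (digits x n) ∧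
      x = cfVal (gaussMap^[n] x) (digits x n) := by
  induction n generalizing x with
  | zero => exact ⟨hx, by simp [digits, PosWord.nil], by simp [digits, cfVal]⟩
  | succ n ih =>
    obtain ⟨h1, h2, h3, h4⟩ := gaussMap_spec hx hirr
    obtain ⟨h5, h6, h7⟩ := ih h1 h2
    rw [Function.iterate_succ_apply, digits_succ]
    refine ⟨h5, posWord_cons.2 ⟨h3, h6⟩, ?_⟩
    rw [cfVal, ← h7]
    exact h4

lemma not_forall_iterate_mem_of_eq_div (d p : ℕ) (x : ℝ) (hx : x = p / d)
    (h : ∀ n, gaussMap^[n] x ∈ Ioo (0 : ℝ) 1) : False := by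
  induction d using Nat.strong_induction_on generalizing p x with
  | _ d ih =>
    have h0 : x ∈ Ioo (0 : ℝ) 1 := h 0
    have hd : (0 : ℝ) < d := by
      rcases Nat.eq_zero_or_pos d with h' | h'
      · subst h'
        have := h0.1
        simp [hx] at this
      · exact_mod_cast h'
    have hpd : p < d := by
      have := h0.2
      rw [hx, div_lt_one hd] at this
      exact_mod_cast this
    refine ih p hpd (d % p) (gaussMap x) ?_ fun n => ?_
    · rw [gaussMap, hx, one_div_div]
      exact Int.fract_div_natCast_eq_div_natCast_mod
    · rw [← Function.iterate_succ_apply]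
      exact h _

lemma irrational_of_forall_iterate_mem {x : ℝ} (h : ∀ n, gaussMap^[n] x ∈ Ioo (0 : ℝ) 1) :
    Irrational x := by
  rintro ⟨r, hr⟩
  have h0 : x ∈ Ioo (0 : ℝ) 1 := h 0
  have hr0 : 0 < r := by
    have := h0.1
    rw [← hr] at this
    exact_mod_cast this
  refine not_forall_iterate_mem_of_eq_div r.den r.num.toNat x ?_ h
  have h1 : ((r.num.toNat : ℤ) : ℝ) = (r.num : ℝ) := by
    rw [Int.toNat_of_nonneg (Rat.num_nonneg.2 hr0.le)]
  rw [← hr]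
  rw [show ((r.num.toNat : ℕ) : ℝ) = (r.num : ℝ) by exact_mod_cast h1]
  exact Rat.cast_def r

lemma length_le_contDen {w : List ℕ} (hw : PosWord w) : w.length ≤ contDen w := by
  induction w using contDen.induct with
  | case1 => simp
  | case2 a => simpa [contDen] using (posWord_cons.1 hw).1
  | case3 a b l ih1 ih2 =>
    have hb := (posWord_cons.1 hw).2
    have ha := (posWord_cons.1 hw).1
    have h1 := ih1 hb
    have h2 : 1 ≤ contDen l := by exact_mod_cast one_le_contDen (posWord_cons.1 hb).2
    rw [contDen]
    simp only [List.length_cons] at h1 ⊢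
    nlinarith

lemma exists_tendsto_cfVal {a : ℕ → ℕ} (ha : ∀ i, 1 ≤ a i) :
    ∃ x, Tendsto (fun n => cfVal 0 ((List.range n).map a)) atTop (nhds x) := by
  have hpos : ∀ n (f : ℕ → ℕ), (∀ i, 1 ≤ f i) → PosWord ((List.range n).map f) := by
    intro n f hf b hb
    obtain ⟨i, -, rfl⟩ := List.mem_map.1 hb
    exact hf i
  have key : ∀ N n, N ≤ n → ∃ t ∈ Icc (0 : ℝ) 1,
      cfVal 0 ((List.range n).map a) = cfVal t ((List.range N).map a) := by
    intro N n hn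
    obtain ⟨m, rfl⟩ := Nat.exists_eq_add_of_le hn
    rw [List.range_add, List.map_append, cfVal_append, List.map_map]
    exact ⟨_, cfVal_mem_Icc ⟨le_rfl, zero_le_one⟩ (hpos _ _ fun i => ha _), rfl⟩
  refine cauchySeq_tendsto_of_complete (cauchySeq_of_le_tendsto_0
    (fun N : ℕ => 2 * (1 / ((N : ℝ) + 1)))
    ?_ ?_)
  · intro n m N hn hm
    obtain ⟨s, hs, hs'⟩ := key N n hn
    obtain ⟨t, ht, ht'⟩ := key N m hm
    rw [hs', ht', Real.dist_eq]
    refine (abs_cfVal_sub_le hs ht (hpos N a ha)).trans ?_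
    have h1 := one_le_contDen (hpos N a ha)
    have h2 : ((N : ℕ) : ℝ) ≤ contDen ((List.range N).map a) := by
      have := length_le_contDen (hpos N a ha)
      simp only [List.length_map, List.length_range] at this
      exact_mod_cast this
    set q : ℝ := ((contDen ((List.range N).map a) : ℕ) : ℝ)
    rw [mul_one_div, div_le_div_iff₀ (by positivity) (by positivity)]
    nlinarith
  · simpa using (tendsto_one_div_add_atTop_nhds_zero_nat (𝕜 := ℝ)).const_mul 2

/-- The number with continued fraction digits `a 0, a 1, …`. -/
noncomputable def cfPoint (a : ℕ → ℕ) : ℝ :=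
  limUnder atTop fun n => cfVal 0 ((List.range n).map a)

lemma tendsto_cfPoint {a : ℕ → ℕ} (ha : ∀ i, 1 ≤ a i) :
    Tendsto (fun n => cfVal 0 ((List.range n).map a)) atTop (nhds (cfPoint a)) :=
  tendsto_nhds_limUnder (exists_tendsto_cfVal ha)

lemma cfPoint_mem_Icc {a : ℕ → ℕ} (ha : ∀ i, 1 ≤ a i) : cfPoint a ∈ Icc (0 : ℝ) 1 := by
  refine isClosed_Icc.mem_of_tendsto (tendsto_cfPoint ha) (Eventually.of_forall fun n => ?_)
  refine cfVal_mem_Icc ⟨le_rfl, zero_le_one⟩ fun b hb => ?_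
  obtain ⟨i, -, rfl⟩ := List.mem_map.1 hb
  exact ha i

lemma cfPoint_eq {a : ℕ → ℕ} (ha : ∀ i, 1 ≤ a i) :
    cfPoint a = 1 / (a 0 + cfPoint fun i => a (i + 1)) := by
  have h1 := (tendsto_add_atTop_iff_nat 1).2 (tendsto_cfPoint ha)
  refine tendsto_nhds_unique h1 ?_
  have h2 := tendsto_cfPoint (a := fun i => a (i + 1)) fun i => ha _
  have h3 := cfPoint_mem_Icc (a := fun i => a (i + 1)) fun i => ha _
  have h4 : (1 : ℝ) ≤ a 0 := by exact_mod_cast ha 0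
  have h5 : (a 0 : ℝ) + cfPoint (fun i => a (i + 1)) ≠ 0 := by linarith [h3.1]
  refine (tendsto_const_nhds.div (h2.const_add (a 0 : ℝ)) h5).congr fun n => ?_
  rw [List.range_succ_eq_map, List.map_cons, cfVal, List.map_map]
  rfl

lemma cfPoint_pos {a : ℕ → ℕ} (ha : ∀ i, 1 ≤ a i) : 0 < cfPoint a := by
  rw [cfPoint_eq ha]
  have h3 := cfPoint_mem_Icc (a := fun i => a (i + 1)) fun i => ha _
  have h4 : (1 : ℝ) ≤ a 0 := by exact_mod_cast ha 0
  have : (0 : ℝ) < a 0 + cfPoint (fun i => a (i + 1)) := by linarith [h3.1]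
  positivity

lemma cfPoint_mem_Ioo {a : ℕ → ℕ} (ha : ∀ i, 1 ≤ a i) : cfPoint a ∈ Ioo (0 : ℝ) 1 := by
  refine ⟨cfPoint_pos ha, ?_⟩
  rw [cfPoint_eq ha]
  have h3 := cfPoint_pos (a := fun i => a (i + 1)) fun i => ha _
  have h4 : (1 : ℝ) ≤ a 0 := by exact_mod_cast ha 0
  rw [div_lt_one (by linarith)]
  linarith

lemma gaussMap_cfPoint {a : ℕ → ℕ} (ha : ∀ i, 1 ≤ a i) :
    gaussMap (cfPoint a) = cfPoint fun i => a (i + 1) := by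
  have h3 := cfPoint_mem_Ioo (a := fun i => a (i + 1)) fun i => ha _
  rw [gaussMap, cfPoint_eq ha, one_div_one_div, Int.fract_natCast_add]
  exact Int.fract_eq_self.2 ⟨h3.1.le, h3.2⟩

lemma gaussMap_iterate_cfPoint {a : ℕ → ℕ} (ha : ∀ i, 1 ≤ a i) (n : ℕ) :
    gaussMap^[n] (cfPoint a) = cfPoint fun i => a (n + i) := by
  induction n generalizing a with
  | zero => simp
  | succ n ih =>
    rw [Function.iterate_succ_apply, gaussMap_cfPoint ha, ih fun i => ha _]
    congr 1
    ext i
    congr 1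
    ring

lemma irrational_cfPoint {a : ℕ → ℕ} (ha : ∀ i, 1 ≤ a i) : Irrational (cfPoint a) :=
  irrational_of_forall_iterate_mem fun n => by
    rw [gaussMap_iterate_cfPoint ha]
    exact cfPoint_mem_Ioo fun i => ha _

lemma pq_cfPoint {a : ℕ → ℕ} (ha : ∀ i, 1 ≤ a i) (n : ℕ) : pq (cfPoint a) (n + 1) = a n := by
  have h3 := cfPoint_mem_Ioo (a := fun i => a (n + (i + 1))) fun i => ha _
  rw [pq, Nat.add_sub_cancel, gaussMap_iterate_cfPoint ha, cfPoint_eq fun i => ha _,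
    one_div_one_div, Nat.floor_eq_iff (by linarith [h3.1, Nat.cast_nonneg (α := ℝ) (a (n + 0))])]
  constructor <;> simp only [add_zero] <;> linarith [h3.1, h3.2]

lemma cfPoint_eq_cfVal {a : ℕ → ℕ} (ha : ∀ i, 1 ≤ a i) (n : ℕ) :
    cfPoint a = cfVal (cfPoint fun i => a (n + i)) ((List.range n).map a) := by
  obtain ⟨-, -, h⟩ := gaussMap_iterate_spec (cfPoint_mem_Ioo ha) (irrational_cfPoint ha) n
  rw [gaussMap_iterate_cfPoint ha] at h
  rw [digits] at h
  simpa only [pq_cfPoint ha] using h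

/-! ### Sums over words -/

/-- The weight `q(w)^{-2θ}` of a word. -/
noncomputable def wt (θ : ℝ) (w : List ℕ) : ℝ≥0∞ :=
  ENNReal.ofReal ((contDen w : ℝ) ^ (-(2 * θ)))

/-- The sum of the weights of the words in a set. -/
noncomputable def wsum (θ : ℝ) (A : Set (List ℕ)) : ℝ≥0∞ := ∑' w : A, wt θ w

lemma tsum_prod_mul_eq_tsum_mul_tsum {α β : Type*} (f : α → ℝ≥0∞) (g : β → ℝ≥0∞) :
    ∑' p : α × β, f p.1 * g p.2 = (∑' a, f a) * ∑' b, g b := by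
  rw [ENNReal.tsum_prod (f := fun a b => f a * g b)]
  simp_rw [ENNReal.tsum_mul_left, ENNReal.tsum_mul_right]

lemma wt_append_le {θ : ℝ} (hθ : 0 ≤ θ) {u v : List ℕ} (hu : PosWord u) (hv : PosWord v) :
    wt θ (u ++ v) ≤ wt θ u * wt θ v := by
  have h1 := one_le_contDen hu
  have h2 := one_le_contDen hv
  rw [wt, wt, wt, ← ENNReal.ofReal_mul (by positivity),
    ← Real.mul_rpow (by positivity) (by positivity)]
  exact ENNReal.ofReal_le_ofReal
    (Real.rpow_le_rpow_of_nonpos (by positivity) (contDen_mul_le hu hv) (by linarith))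

lemma wt_anti {θ θ' : ℝ} (h : θ ≤ θ') {w : List ℕ} (hw : PosWord w) : wt θ' w ≤ wt θ w :=
  ENNReal.ofReal_le_ofReal
    (Real.rpow_le_rpow_of_exponent_le (one_le_contDen hw) (by linarith))

lemma wsum_image2_append_le {θ : ℝ} (hθ : 0 ≤ θ) {A B : Set (List ℕ)} (hA : ∀ w ∈ A, PosWord w)
    (hB : ∀ w ∈ B, PosWord w) : wsum θ (image2 (· ++ ·) A B) ≤ wsum θ A * wsum θ B := by
  let φ : A × B → image2 (· ++ ·) A B := fun p => ⟨p.1 ++ p.2, mem_image2_of_mem p.1.2 p.2.2⟩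
  have hφ : Function.Surjective φ := by
    rintro ⟨_, u, hu, v, hv, rfl⟩
    exact ⟨(⟨u, hu⟩, ⟨v, hv⟩), rfl⟩
  calc wsum θ (image2 (· ++ ·) A B) ≤ ∑' p : A × B, wt θ (φ p) :=
        ENNReal.tsum_le_tsum_comp_of_surjective hφ fun w => wt θ w
    _ ≤ ∑' p : A × B, wt θ p.1 * wt θ p.2 :=
        ENNReal.tsum_le_tsum fun p => wt_append_le hθ (hA _ p.1.2) (hB _ p.2.2)
    _ = wsum θ A * wsum θ B :=
        tsum_prod_mul_eq_tsum_mul_tsum (fun w : A => wt θ w) fun w : B => wt θ w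

/-- Two-letter words with product of the letters at least `T`. -/
def pairWords (T : ℝ) : Set (List ℕ) :=
  {w | ∃ a b : ℕ, 1 ≤ a ∧ 1 ≤ b ∧ T ≤ (a : ℝ) * b ∧ w = [a, b]}

/-- Words of length `n` with positive letters. -/
def freeWords (n : ℕ) : Set (List ℕ) := {w | w.length = n ∧ PosWord w}

lemma wsum_pairWords_le {θ η T : ℝ} (hη : 0 ≤ 2 * θ - (1 + η)) (hη0 : 0 < η) (hT : 0 < T) :
    wsum θ (pairWords T) ≤ ENNReal.ofReal (T ^ (-(2 * θ - (1 + η)))) *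
      ((∑' a : ℕ, ENNReal.ofReal ((a : ℝ) ^ (-(1 + η)))) *
        ∑' a : ℕ, ENNReal.ofReal ((a : ℝ) ^ (-(1 + η)))) := by
  let S : Set (ℕ × ℕ) := {p | 1 ≤ p.1 ∧ 1 ≤ p.2 ∧ T ≤ (p.1 : ℝ) * p.2}
  let φ : S → pairWords T := fun p =>
    ⟨[p.1.1, p.1.2], p.1.1, p.1.2, p.2.1, p.2.2.1, p.2.2.2, rfl⟩
  have hφ : Function.Surjective φ := by
    rintro ⟨_, a, b, ha, hb, hab, rfl⟩
    exact ⟨⟨(a, b), ha, hb, hab⟩, rfl⟩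
  let g : ℕ × ℕ → ℝ≥0∞ := fun p => ENNReal.ofReal (T ^ (-(2 * θ - (1 + η)))) *
    (ENNReal.ofReal ((p.1 : ℝ) ^ (-(1 + η))) * ENNReal.ofReal ((p.2 : ℝ) ^ (-(1 + η))))
  calc wsum θ (pairWords T) ≤ ∑' p : S, wt θ (φ p) :=
        ENNReal.tsum_le_tsum_comp_of_surjective hφ fun w => wt θ w
    _ ≤ ∑' p : S, g p := by
        refine ENNReal.tsum_le_tsum fun p => ?_
        obtain ⟨⟨a, b⟩, ha, hb, hab⟩ := p
        simp only at ha hb hab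
        have ha' : (0 : ℝ) < a := by exact_mod_cast ha
        have hb' : (0 : ℝ) < b := by exact_mod_cast hb
        have hab0 : 0 < (a : ℝ) * b := by positivity
        simp only [φ, g, wt]
        rw [← ENNReal.ofReal_mul (by positivity), ← ENNReal.ofReal_mul (by positivity),
          ← Real.mul_rpow ha'.le hb'.le]
        refine ENNReal.ofReal_le_ofReal ?_
        calc ((contDen [a, b] : ℕ) : ℝ) ^ (-(2 * θ)) ≤ ((a : ℝ) * b) ^ (-(2 * θ)) := by
              refine Real.rpow_le_rpow_of_nonpos hab0 ?_ (by linarith)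
              simp [contDen]
          _ = ((a : ℝ) * b) ^ (-(2 * θ - (1 + η))) * ((a : ℝ) * b) ^ (-(1 + η)) := by
              rw [← Real.rpow_add hab0]
              congr 1
              ring
          _ ≤ _ := by
              refine mul_le_mul_of_nonneg_right ?_ (by positivity)
              exact Real.rpow_le_rpow_of_nonpos hT hab (by linarith)
    _ ≤ ∑' p : ℕ × ℕ, g p := ENNReal.tsum_comp_le_tsum_of_injective Subtype.val_injective g
    _ = _ := by
        simp only [g]
        rw [ENNReal.tsum_mul_left]
        exact congrArg _ (tsum_prod_mul_eq_tsum_mul_tsum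
          (fun a : ℕ => ENNReal.ofReal ((a : ℝ) ^ (-(1 + η))))
          fun a : ℕ => ENNReal.ofReal ((a : ℝ) ^ (-(1 + η))))

lemma tsum_rpow_ne_top {η : ℝ} (hη : 0 < η) :
    ∑' a : ℕ, ENNReal.ofReal ((a : ℝ) ^ (-(1 + η))) ≠ ∞ :=
  (Real.summable_nat_rpow.2 (by linarith)).tsum_ofReal_ne_top

/-- The word attached to a function on `Fin n`. -/
def fnWord {n : ℕ} (a : Fin n → ℕ+) : List ℕ := List.ofFn fun i => (a i : ℕ)

lemma posWord_fnWord {n : ℕ} (a : Fin n → ℕ+) : PosWord (fnWord a) := by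
  intro b hb
  obtain ⟨i, rfl⟩ := List.mem_ofFn.1 hb
  exact (a i).2

lemma fnWord_injective {n : ℕ} : Function.Injective (fnWord (n := n)) := by
  intro a b h
  funext i
  exact PNat.eq (congrFun (List.ofFn_injective h) i)

lemma wsum_freeWords_le {θ₀ : ℝ} (n : ℕ)
    (hs : Summable fun a : Fin n → ℕ+ => ((contDen (fnWord a) : ℝ) ^ (-(2 * θ₀)))) :
    wsum θ₀ (freeWords n) ≤
      ENNReal.ofReal (∑' a : Fin n → ℕ+, (contDen (fnWord a) : ℝ) ^ (-(2 * θ₀))) := by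
  let φ : (Fin n → ℕ+) → freeWords n := fun a => ⟨fnWord a, by simp [fnWord], posWord_fnWord a⟩
  have hφ : Function.Surjective φ := by
    rintro ⟨w, rfl, hw⟩
    refine ⟨fun i => ⟨w.get i, hw _ (List.get_mem _ _)⟩, ?_⟩
    simp [φ, fnWord]
  rw [ENNReal.ofReal_tsum_of_nonneg (fun a => by positivity) hs]
  exact ENNReal.tsum_le_tsum_comp_of_surjective hφ fun w => wt θ₀ w

lemma pressure_bounds {θ₀ p : ℝ} (hp : 0 < p)
    (hP : Tendsto (fun n : ℕ => (1 / n : ℝ) *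
        Real.log (∑' a : Fin n → ℕ+, (contDen (fnWord a) : ℝ) ^ (-(2 * θ₀)))) atTop (nhds p))
    {δ : ℝ} (hδ : 0 < δ) : ∀ᶠ n : ℕ in atTop,
      (Summable fun a : Fin n → ℕ+ => ((contDen (fnWord a) : ℝ) ^ (-(2 * θ₀)))) ∧
      Real.exp (n * (p - δ)) ≤ ∑' a : Fin n → ℕ+, (contDen (fnWord a) : ℝ) ^ (-(2 * θ₀)) ∧
      ∑' a : Fin n → ℕ+, (contDen (fnWord a) : ℝ) ^ (-(2 * θ₀)) ≤ Real.exp (n * (p + δ)) := by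
  filter_upwards [hP.eventually (lt_mem_nhds hp), hP.eventually (lt_mem_nhds (sub_lt_self p hδ)),
    hP.eventually (gt_mem_nhds (lt_add_of_pos_right p hδ)), eventually_gt_atTop 0]
    with n h0 h1 h2 hn
  have hn' : (0 : ℝ) < n := by exact_mod_cast hn
  set Z := ∑' a : Fin n → ℕ+, (contDen (fnWord a) : ℝ) ^ (-(2 * θ₀)) with hZ
  have hZne : Z ≠ 0 := by
    intro h
    simp [h] at h0
  have hZpos : 0 < Z := lt_of_le_of_ne (tsum_nonneg fun a => by positivity) hZne.symm
  refine ⟨by_contra fun hs => hZne (tsum_eq_zero_of_not_summable hs), ?_, ?_⟩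
  · rw [← Real.le_log_iff_exp_le hZpos]
    rw [one_div, inv_mul_eq_div, lt_div_iff₀ hn'] at h1
    linarith
  · rw [← Real.log_le_iff_le_exp hZpos]
    rw [one_div, inv_mul_eq_div, div_lt_iff₀ hn'] at h2
    linarith

/-! ### The upper bound -/

/-- Admissible words for the positions `k², …, (k+1)² - 1`. -/
def blockWords (c : ℝ) (k : ℕ) : Set (List ℕ) :=
  image2 (· ++ ·) (pairWords (Real.exp (c * k) / 2)) (freeWords (2 * k - 1))

lemma posWord_of_mem_image2 {A B : Set (List ℕ)} (hA : ∀ w ∈ A, PosWord w)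
    (hB : ∀ w ∈ B, PosWord w) : ∀ w ∈ image2 (· ++ ·) A B, PosWord w := by
  rintro _ ⟨u, hu, v, hv, rfl⟩
  exact posWord_append.2 ⟨hA u hu, hB v hv⟩

lemma posWord_pairWords {T : ℝ} : ∀ w ∈ pairWords T, PosWord w := by
  rintro _ ⟨a, b, ha, hb, -, rfl⟩
  exact posWord_cons.2 ⟨ha, posWord_cons.2 ⟨hb, PosWord.nil⟩⟩

lemma posWord_blockWords {c : ℝ} {k : ℕ} : ∀ w ∈ blockWords c k, PosWord w :=
  posWord_of_mem_image2 posWord_pairWords fun _ h => h.2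

lemma tendsto_wsum_blockWords {c θ₀ θ : ℝ} (hc : 0 < c) (hθ₁ : 1 / 2 < θ₀) (hθ : θ₀ < θ)
    (hP : Tendsto (fun n : ℕ => (1 / n : ℝ) *
        Real.log (∑' a : Fin n → ℕ+, (contDen (fnWord a) : ℝ) ^ (-(2 * θ₀))))
      atTop (nhds (c * (θ₀ - 1 / 2)))) :
    Tendsto (fun k => wsum θ (blockWords c k)) atTop (nhds 0) := by
  set η := θ - θ₀ with hη
  have hη0 : 0 < η := sub_pos.2 hθ
  set K : ℝ≥0∞ := (∑' a : ℕ, ENNReal.ofReal ((a : ℝ) ^ (-(1 + η)))) *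
    ∑' a : ℕ, ENNReal.ofReal ((a : ℝ) ^ (-(1 + η))) with hK
  have hKtop : K ≠ ∞ := ENNReal.mul_ne_top (tsum_rpow_ne_top hη0) (tsum_rpow_ne_top hη0)
  set D : ℝ := 2 * θ - (1 + η) with hD
  have hD0 : 0 < D := by linarith
  have hp : 0 < c * (θ₀ - 1 / 2) := mul_pos hc (by linarith)
  set p := c * (θ₀ - 1 / 2) with hpdef
  have hcη : 0 < c * η := mul_pos hc hη0
  have hδ : 0 < c * η / 4 := by linarith
  have htend : Tendsto (fun k : ℕ =>
      ENNReal.ofReal (Real.exp (D * Real.log 2 + (k : ℝ) * -(c * η / 2))) * K)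
      atTop (nhds 0) := by
    have h1 : Tendsto (fun k : ℕ => Real.exp (D * Real.log 2 + (k : ℝ) * -(c * η / 2))) atTop
        (nhds 0) := by
      refine Real.tendsto_exp_atBot.comp (tendsto_atBot_add_const_left _ _ ?_)
      exact tendsto_natCast_atTop_atTop.atTop_mul_const_of_neg (by linarith)
    have h2 := ENNReal.Tendsto.mul_const (ENNReal.tendsto_ofReal h1) (Or.inr hKtop)
    simpa using h2
  refine tendsto_of_tendsto_of_tendsto_of_le_of_le' tendsto_const_nhds htend
    (Eventually.of_forall fun _ => zero_le) ?_
  have hn : Tendsto (fun k : ℕ => 2 * k - 1) atTop atTop :=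
    tendsto_atTop_mono (fun k => by simp only [id]; omega) tendsto_id
  filter_upwards [hn.eventually (pressure_bounds hp hP hδ), eventually_ge_atTop 1]
    with k ⟨hs, _, hle⟩ hk
  have hk' : ((2 * k - 1 : ℕ) : ℝ) ≤ 2 * k := by
    have : 2 * k - 1 ≤ 2 * k := by omega
    exact_mod_cast this
  have hT : 0 < Real.exp (c * k) / 2 := by positivity
  have hfree : wsum θ (freeWords (2 * k - 1)) ≤
      ENNReal.ofReal (Real.exp (2 * k * (p + c * η / 4))) := by
    refine (ENNReal.tsum_le_tsum fun w : freeWords (2 * k - 1) => wt_anti hθ.le w.2.2).trans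
      ((wsum_freeWords_le _ hs).trans (ENNReal.ofReal_le_ofReal (hle.trans ?_)))
    rw [Real.exp_le_exp]
    exact mul_le_mul_of_nonneg_right hk' (by linarith)
  calc wsum θ (blockWords c k)
      ≤ wsum θ (pairWords (Real.exp (c * k) / 2)) * wsum θ (freeWords (2 * k - 1)) :=
        wsum_image2_append_le (by linarith) posWord_pairWords fun _ h => h.2
    _ ≤ (ENNReal.ofReal ((Real.exp (c * k) / 2) ^ (-D)) * K) *
          ENNReal.ofReal (Real.exp (2 * k * (p + c * η / 4))) :=
        mul_le_mul' (wsum_pairWords_le hD0.le hη0 hT) hfree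
    _ = ENNReal.ofReal (Real.exp (D * Real.log 2 + (k : ℝ) * -(c * η / 2))) * K := by
        rw [mul_right_comm, ← ENNReal.ofReal_mul (by positivity)]
        congr 2
        rw [Real.rpow_def_of_pos hT, ← Real.exp_add, Real.log_div (by positivity) (by norm_num),
          Real.log_exp]
        congr 1
        rw [hD, hpdef, hη]
        ring

/-- Concatenations of `v` with consecutive blocks. -/
def coverWords (c : ℝ) (K : ℕ) (v : List ℕ) : ℕ → Set (List ℕ)
  | 0 => {v}
  | i + 1 => image2 (· ++ ·) (coverWords c K v i) (blockWords c (K + i))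

lemma posWord_coverWords {c : ℝ} {K : ℕ} {v : List ℕ} (hv : PosWord v) (i : ℕ) :
    ∀ w ∈ coverWords c K v i, PosWord w := by
  induction i with
  | zero =>
    rintro _ rfl
    exact hv
  | succ i ih => exact posWord_of_mem_image2 ih posWord_blockWords

lemma wsum_coverWords_le {c θ : ℝ} (hθ : 0 ≤ θ) {K : ℕ}
    (hK : ∀ k ≥ K, wsum θ (blockWords c k) ≤ 2⁻¹) {v : List ℕ} (hv : PosWord v) (i : ℕ) :
    wsum θ (coverWords c K v i) ≤ wt θ v * 2⁻¹ ^ i := by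
  induction i with
  | zero => simp [wsum, coverWords]
  | succ i ih =>
    rw [pow_succ, ← mul_assoc]
    exact (wsum_image2_append_le hθ (posWord_coverWords hv i) posWord_blockWords).trans
      (mul_le_mul' ih (hK _ (Nat.le_add_right _ _)))

lemma posWord_map_pq {x : ℝ} (hx : x ∈ Ioo (0 : ℝ) 1) (hirr : Irrational x) (i : ℕ) :
    1 ≤ pq x (i + 1) := by
  have h := (gaussMap_iterate_spec hx hirr (i + 1)).2.1
  exact h _ (List.mem_map.2 ⟨i, by simp, rfl⟩)

lemma digits_add (x : ℝ) (m n : ℕ) :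
    digits x (m + n) = digits x m ++ (List.range n).map fun i => pq x (m + i + 1) := by
  simp [digits, List.range_add, Function.comp_def]

lemma digits_mem_coverWords {c : ℝ} {K : ℕ} (hK1 : 1 ≤ K) {x : ℝ} (hx : x ∈ Ioo (0 : ℝ) 1)
    (hirr : Irrational x)
    (h : ∀ k ≥ K, Real.exp (c * k) / 2 ≤ (pq x (k ^ 2) : ℝ) * pq x (k ^ 2 + 1)) (i : ℕ) :
    digits x ((K + i) ^ 2 - 1) ∈ coverWords c K (digits x (K ^ 2 - 1)) i := by
  induction i with
  | zero => exact rfl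
  | succ i ih =>
    set k := K + i with hk
    have hk1 : 1 ≤ k := by omega
    have hk2 : 1 ≤ k ^ 2 := Nat.one_le_pow _ _ hk1
    have e : (K + (i + 1)) ^ 2 - 1 = (k ^ 2 - 1) + 2 + (2 * k - 1) := by
      rw [← add_assoc, ← hk]
      have : (k + 1) ^ 2 = k ^ 2 + 2 * k + 1 := by ring
      omega
    rw [e, add_assoc, digits_add]
    refine ⟨_, ih, _, ?_, rfl⟩
    rw [List.range_add, List.map_append]
    refine ⟨_, ⟨pq x (k ^ 2), pq x (k ^ 2 + 1), ?_, posWord_map_pq hx hirr _, h k (by omega), ?_⟩,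
      _, ⟨?_, ?_⟩, rfl⟩
    · obtain ⟨m, hm⟩ := Nat.exists_eq_add_of_le' hk2
      rw [hm]
      exact posWord_map_pq hx hirr m
    · simp only [List.range_succ, List.range_zero, List.nil_append, List.map_cons, List.map_nil,
        List.cons_append]
      rw [show k ^ 2 - 1 + 0 + 1 = k ^ 2 by omega]
    · simp [hk]
    · intro b hb
      simp only [List.mem_map] at hb
      obtain ⟨j, -, rfl⟩ := hb
      exact posWord_map_pq hx hirr _

/-- Real numbers in `[0,1]` whose expansion starts with `w`. -/
def cylinder (w : List ℕ) : Set ℝ := (fun t => cfVal t w) '' Icc 0 1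

lemma ediam_cylinder_rpow_le {θ : ℝ} (hθ : 0 < θ) {w : List ℕ} (hw : PosWord w) :
    Metric.ediam (cylinder w) ^ θ ≤ wt θ w := by
  have h1 := one_le_contDen hw
  have h : Metric.ediam (cylinder w) ≤ ENNReal.ofReal (1 / (contDen w : ℝ) ^ 2) := by
    refine Metric.ediam_le ?_
    rintro _ ⟨s, hs, rfl⟩ _ ⟨t, ht, rfl⟩
    rw [edist_dist, Real.dist_eq]
    exact ENNReal.ofReal_le_ofReal (abs_cfVal_sub_le hs ht hw)
  refine (ENNReal.rpow_le_rpow h hθ.le).trans_eq ?_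
  rw [ENNReal.ofReal_rpow_of_nonneg (by positivity) hθ.le, wt]
  congr 1
  rw [one_div, ← Real.rpow_natCast, ← Real.rpow_neg (by positivity),
    ← Real.rpow_mul (by positivity)]
  congr 1
  push_cast
  ring

lemma hausdorffMeasure_tail_eq_zero {c θ : ℝ} (hθ : 0 < θ) {K : ℕ} (hK1 : 1 ≤ K)
    (hK : ∀ k ≥ K, wsum θ (blockWords c k) ≤ 2⁻¹) {v : List ℕ} (hv : PosWord v) :
    MeasureTheory.Measure.hausdorffMeasure θ
      {x : ℝ | x ∈ Ioo (0 : ℝ) 1 ∧ Irrational x ∧ digits x (K ^ 2 - 1) = v ∧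
        ∀ k ≥ K, Real.exp (c * k) / 2 ≤ (pq x (k ^ 2) : ℝ) * pq x (k ^ 2 + 1)} = 0 := by
  classical
  have hr : Tendsto (fun i : ℕ => wt θ v * 2⁻¹ ^ i) atTop (nhds 0) := by
    have := ENNReal.Tendsto.const_mul (a := wt θ v)
      (ENNReal.tendsto_pow_atTop_nhds_zero_of_lt_one (r := 2⁻¹) (by norm_num))
      (Or.inr ENNReal.ofReal_ne_top)
    simpa using this
  have hr' : Tendsto (fun i : ℕ => (wt θ v * 2⁻¹ ^ i) ^ θ⁻¹) atTop (nhds 0) := by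
    have := (ENNReal.continuous_rpow_const (y := θ⁻¹)).tendsto 0 |>.comp hr
    simpa [Function.comp_def, ENNReal.zero_rpow_of_pos (inv_pos.2 hθ)] using this
  let t : ℕ → List ℕ → Set ℝ := fun i w => if w ∈ coverWords c K v i then cylinder w else ∅
  have hsum : ∀ i, ∑' w, Metric.ediam (t i w) ^ θ ≤ wt θ v * 2⁻¹ ^ i := by
    intro i
    refine le_trans ?_ (wsum_coverWords_le hθ.le hK hv i)
    rw [wsum, tsum_subtype (coverWords c K v i) (wt θ)]
    refine ENNReal.tsum_le_tsum fun w => ?_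
    by_cases hw : w ∈ coverWords c K v i
    · simp only [t, hw, if_true, indicator_of_mem]
      exact ediam_cylinder_rpow_le hθ (posWord_coverWords hv i w hw)
    · simp [t, hw, ENNReal.zero_rpow_of_pos hθ]
  refine le_antisymm ((MeasureTheory.Measure.hausdorffMeasure_le_liminf_tsum θ _ _ hr' t
    (Eventually.of_forall fun i w => ?_) (Eventually.of_forall fun i => ?_)).trans ?_) zero_le
  · rw [ENNReal.le_rpow_inv_iff hθ]
    exact (ENNReal.le_tsum w).trans (hsum i)
  · rintro x ⟨hx, hirr, hxv, hxk⟩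
    obtain ⟨h1, -, h3⟩ := gaussMap_iterate_spec hx hirr ((K + i) ^ 2 - 1)
    have hmem := digits_mem_coverWords hK1 hx hirr hxk i
    rw [hxv] at hmem
    refine mem_iUnion.2 ⟨digits x ((K + i) ^ 2 - 1), ?_⟩
    simp only [t, hmem, if_true]
    exact ⟨_, ⟨h1.1.le, h1.2.le⟩, h3.symm⟩
  · refine (liminf_le_liminf (Eventually.of_forall hsum)).trans_eq ?_
    exact hr.liminf_eq

lemma exists_forall_le_pq_mul_of_mem_Lset {c : ℝ} (hc : 0 < c) {x : ℝ}
    (hx : x ∈ Lset fun n : ℕ => Real.exp (c * Nat.sqrt n)) :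
    ∃ K : ℕ, ∀ k ≥ K, Real.exp (c * k) / 2 ≤ (pq x (k ^ 2) : ℝ) * pq x (k ^ 2 + 1) := by
  obtain ⟨-, -, hlim⟩ := hx
  set r := Real.exp (-c) with hr
  have hr0 : 0 < r := Real.exp_pos _
  have hr1 : r < 1 := by rw [hr, Real.exp_lt_one_iff]; linarith
  set ε := (1 - r) / (2 * (1 + r)) with hε
  have hε0 : 0 < ε := div_pos (by linarith) (by linarith)
  have hε1 : ε ≤ 1 / 2 := by rw [hε, div_le_iff₀ (by linarith)]; linarith
  have hε2 : (1 + ε) * r < 1 - ε := by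
    have : ε * (2 * (1 + r)) = 1 - r := by rw [hε]; field_simp
    nlinarith
  obtain ⟨N, hN⟩ := eventually_atTop.1 ((hlim.eventually (lt_mem_nhds (sub_lt_self 1 hε0))).and
    (hlim.eventually (gt_mem_nhds (lt_add_of_pos_right 1 hε0))))
  refine ⟨N + 2, fun k hk => ?_⟩
  have hk2 : N + 1 ≤ k ^ 2 - 1 := by
    have : (N + 2) ^ 2 ≤ k ^ 2 := Nat.pow_le_pow_left hk 2
    have h : (N + 2) ^ 2 = N ^ 2 + 4 * N + 4 := by ring
    have := Nat.zero_le (N ^ 2)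
    omega
  have h1 := (hN (k ^ 2) (by omega)).1
  have h2 := (hN (k ^ 2 - 1) (by omega)).2
  have hs1 : Nat.sqrt (k ^ 2) = k := Nat.sqrt_eq' k
  have hs2 : Nat.sqrt (k ^ 2 - 1) = k - 1 := by
    obtain ⟨m, rfl⟩ := Nat.exists_eq_add_of_le' (show 1 ≤ k by omega)
    have : (m + 1) ^ 2 - 1 = m * m + (m + m) := by
      have : (m + 1) ^ 2 = m * m + (m + m) + 1 := by ring
      omega
    rw [this, Nat.sqrt_add_eq m le_rfl]
    rfl
  simp only [hs1, hs2] at h1 h2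
  rw [lt_div_iff₀ (Real.exp_pos _)] at h1
  rw [div_lt_iff₀ (Real.exp_pos _)] at h2
  have he : Real.exp (c * ((k - 1 : ℕ) : ℝ)) = Real.exp (c * k) * r := by
    rw [hr, ← Real.exp_add, Nat.cast_sub (by omega)]
    congr 1
    push_cast
    ring
  rw [he] at h2
  have hM : 0 < Real.exp (c * k) := Real.exp_pos _
  obtain ⟨i, hi, hiL⟩ := Finset.exists_mem_eq_sup (Finset.Icc 1 (k ^ 2))
    ⟨1, Finset.mem_Icc.2 ⟨le_rfl, by omega⟩⟩ fun i => pq x i * pq x (i + 1)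
  rw [Finset.mem_Icc] at hi
  have hik : i = k ^ 2 := by
    by_contra hne
    have h3 : pq x i * pq x (i + 1) ≤ Lmax x (k ^ 2 - 1) :=
      Finset.le_sup (f := fun i => pq x i * pq x (i + 1)) (Finset.mem_Icc.2 ⟨hi.1, by omega⟩)
    have h4 : Lmax x (k ^ 2) ≤ Lmax x (k ^ 2 - 1) := by
      rw [Lmax, hiL]
      exact h3
    have h5 : (Lmax x (k ^ 2) : ℝ) ≤ Lmax x (k ^ 2 - 1) := by exact_mod_cast h4
    nlinarith
  have h6 : (Lmax x (k ^ 2) : ℝ) = (pq x (k ^ 2) : ℝ) * pq x (k ^ 2 + 1) := by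
    rw [Lmax, hiL, hik]
    push_cast
    rfl
  rw [← h6]
  nlinarith

theorem dimH_Lset_le {c θ₀ θ : ℝ} (hc : 0 < c) (hθ₁ : 1 / 2 < θ₀) (hθ : θ₀ < θ)
    (hP : Tendsto (fun n : ℕ => (1 / n : ℝ) *
        Real.log (∑' a : Fin n → ℕ+, (contDen (fnWord a) : ℝ) ^ (-(2 * θ₀))))
      atTop (nhds (c * (θ₀ - 1 / 2)))) :
    dimH (Lset fun n : ℕ => Real.exp (c * Nat.sqrt n)) ≤ ENNReal.ofReal θ := by
  have hθ0 : 0 < θ := by linarith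
  obtain ⟨K₀, hK₀⟩ := eventually_atTop.1
    ((tendsto_wsum_blockWords hc hθ₁ hθ hP).eventually_le_const (u := 2⁻¹) (by simp))
  let E : ℕ × List ℕ → Set ℝ := fun p =>
    {x : ℝ | x ∈ Ioo (0 : ℝ) 1 ∧ Irrational x ∧ digits x ((K₀ + p.1 + 1) ^ 2 - 1) = p.2 ∧
      ∀ k ≥ K₀ + p.1 + 1, Real.exp (c * k) / 2 ≤ (pq x (k ^ 2) : ℝ) * pq x (k ^ 2 + 1)}
  have hsub : Lset (fun n : ℕ => Real.exp (c * Nat.sqrt n)) ⊆ ⋃ p, E p := by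
    intro x hx
    obtain ⟨K, hK⟩ := exists_forall_le_pq_mul_of_mem_Lset hc hx
    exact mem_iUnion.2 ⟨(K, digits x ((K₀ + K + 1) ^ 2 - 1)), hx.1, hx.2.1, rfl,
      fun k hk => hK k (by omega)⟩
  refine (dimH_mono hsub).trans ?_
  rw [dimH_iUnion]
  refine iSup_le fun ⟨K, v⟩ => ?_
  by_cases hv : PosWord v
  · have h0 := hausdorffMeasure_tail_eq_zero (c := c) hθ0 (K := K₀ + K + 1) (by omega)
      (fun k hk => hK₀ k (by omega)) hv
    refine dimH_le_of_hausdorffMeasure_ne_top (d := θ.toNNReal) ?_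
    rw [Real.coe_toNNReal _ hθ0.le]
    exact h0.trans_ne ENNReal.zero_ne_top
  · have : E (K, v) = ∅ := by
      refine eq_empty_of_forall_notMem fun x hx => hv ?_
      have h : digits x _ = v := hx.2.2.1
      rw [← h]
      exact (gaussMap_iterate_spec hx.1 hx.2.1 _).2.1
    rw [this, dimH_empty]
    exact zero_le

/-! ### A mass distribution principle for concatenated blocks -/

lemma wt_mul_le {θ : ℝ} (hθ : 0 ≤ θ) (hθ1 : θ ≤ 1) {u v : List ℕ} (hu : PosWord u)
    (hv : PosWord v) : wt θ u * wt θ v ≤ 4 * wt θ (u ++ v) := by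
  have h1 := one_le_contDen hu
  have h2 := one_le_contDen hv
  have h3 := one_le_contDen (posWord_append.2 ⟨hu, hv⟩)
  have h4 : (4 : ℝ≥0∞) = ENNReal.ofReal 4 := by simp
  rw [wt, wt, wt, h4, ← ENNReal.ofReal_mul (by positivity), ← ENNReal.ofReal_mul (by norm_num),
    ← Real.mul_rpow (by positivity) (by positivity)]
  refine ENNReal.ofReal_le_ofReal ?_
  have h5 : (contDen (u ++ v) : ℝ) / 2 ≤ contDen u * contDen v := by
    linarith [contDen_append_le hu hv]
  calc ((contDen u : ℝ) * contDen v) ^ (-(2 * θ)) ≤ ((contDen (u ++ v) : ℝ) / 2) ^ (-(2 * θ)) :=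
        Real.rpow_le_rpow_of_nonpos (by positivity) h5 (by linarith)
    _ = (2 : ℝ) ^ (2 * θ) * (contDen (u ++ v) : ℝ) ^ (-(2 * θ)) := by
        rw [Real.div_rpow (by positivity) (by norm_num), Real.rpow_neg zero_le_two,
          div_inv_eq_mul, mul_comm]
    _ ≤ (2 : ℝ) ^ (2 : ℝ) * (contDen (u ++ v) : ℝ) ^ (-(2 * θ)) := by
        gcongr
        · norm_num
        · linarith
    _ = 4 * (contDen (u ++ v) : ℝ) ^ (-(2 * θ)) := by norm_num

/-- The infinite word obtained by concatenating words `f k` of length `2 * k + 1`. -/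
def concatSeq (f : ℕ → List ℕ) (i : ℕ) : ℕ := (f (Nat.sqrt i)).getD (i - Nat.sqrt i ^ 2) 1

/-- The concatenation of the first `k` words. -/
def concatPrefix (f : ℕ → List ℕ) : ℕ → List ℕ
  | 0 => []
  | k + 1 => concatPrefix f k ++ f k

lemma concatSeq_sq_add (f : ℕ → List ℕ) {k e : ℕ} (he : e < 2 * k + 1) :
    concatSeq f (k ^ 2 + e) = (f k).getD e 1 := by
  have h : Nat.sqrt (k ^ 2 + e) = k := by
    rw [sq]
    exact Nat.sqrt_add_eq k (by omega)
  rw [concatSeq, h, Nat.add_sub_cancel_left]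

lemma map_concatSeq {f : ℕ → List ℕ} (hf : ∀ k, (f k).length = 2 * k + 1) (k : ℕ) :
    (List.range (k ^ 2)).map (concatSeq f) = concatPrefix f k := by
  induction k with
  | zero => rfl
  | succ k ih =>
    rw [show (k + 1) ^ 2 = k ^ 2 + (2 * k + 1) by ring, List.range_add, List.map_append, ih,
      concatPrefix, List.map_map]
    congr 1
    refine List.ext_getElem (by simp [hf]) fun e h1 h2 => ?_
    have he : e < 2 * k + 1 := by rwa [hf] at h2
    simp [concatSeq_sq_add f he, h2]

lemma concatPrefix_congr {f g : ℕ → List ℕ} {k : ℕ} (h : ∀ j < k, f j = g j) :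
    concatPrefix f k = concatPrefix g k := by
  induction k with
  | zero => rfl
  | succ k ih => rw [concatPrefix, concatPrefix, ih fun j hj => h j (by omega), h k (by omega)]

lemma posWord_concatPrefix {f : ℕ → List ℕ} (hf : ∀ k, PosWord (f k)) (k : ℕ) :
    PosWord (concatPrefix f k) := by
  induction k with
  | zero => exact PosWord.nil
  | succ k ih => exact posWord_append.2 ⟨ih, hf k⟩

lemma one_le_concatSeq {f : ℕ → List ℕ} (hf : ∀ k, PosWord (f k)) (i : ℕ) :
    1 ≤ concatSeq f i := by
  rw [concatSeq]
  rcases lt_or_ge (i - Nat.sqrt i ^ 2) (f (Nat.sqrt i)).length with h | h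
  · rw [List.getD_eq_getElem _ _ h]
    exact hf _ _ (List.getElem_mem h)
  · rw [List.getD_eq_default _ _ h]

lemma prod_wt_le {θ : ℝ} (hθ : 0 ≤ θ) (hθ1 : θ ≤ 1) {f : ℕ → List ℕ} (hf : ∀ k, PosWord (f k))
    (k : ℕ) : ∏ j ∈ Finset.range k, wt θ (f j) ≤ 4 ^ k * wt θ (concatPrefix f k) := by
  induction k with
  | zero => simp [concatPrefix, wt, contDen]
  | succ k ih =>
    rw [Finset.prod_range_succ, pow_succ, concatPrefix, mul_assoc]
    calc _ ≤ 4 ^ k * wt θ (concatPrefix f k) * wt θ (f k) := mul_le_mul_left ih _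
      _ = 4 ^ k * (wt θ (concatPrefix f k) * wt θ (f k)) := mul_assoc _ _ _
      _ ≤ _ := mul_le_mul_right (wt_mul_le hθ hθ1 (posWord_concatPrefix hf k) (hf k)) _

/-- The conditions on the words used at step `k`. -/
structure IsBlock (h k : ℕ) (w : List ℕ) : Prop where
  length_eq : w.length = 2 * k + 1
  posWord : PosWord w
  exists_eq : ∃ u, w = u ++ [1]
  wordSize_le : wordSize w ≤ h ^ (k + 1)

lemma wt_concatPrefix_le {θ : ℝ} (hθ : 0 ≤ θ) (hθ1 : θ ≤ 1) {h : ℕ} (hh : 1 ≤ h)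
    {f g : ℕ → List ℕ} (hf : ∀ k, IsBlock h k (f k)) (hg : ∀ k, IsBlock h k (g k)) {k : ℕ}
    (hfg : ∀ j < k, f j = g j) (hk : f k ≠ g k) :
    wt θ (concatPrefix f k) ≤ 4 * ((h : ℝ≥0∞) ^ (k + 1)) ^ 2 *
      edist (cfPoint (concatSeq f)) (cfPoint (concatSeq g)) ^ θ := by
  have hpos := posWord_concatPrefix (fun k => (hf k).posWord) k
  have hfp := one_le_concatSeq fun k => (hf k).posWord
  have hgp := one_le_concatSeq fun k => (hg k).posWord
  have ef := cfPoint_eq_cfVal hfp ((k + 1) ^ 2)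
  have eg := cfPoint_eq_cfVal hgp ((k + 1) ^ 2)
  rw [map_concatSeq fun k => (hf k).length_eq, concatPrefix, cfVal_append] at ef
  rw [map_concatSeq fun k => (hg k).length_eq, concatPrefix, cfVal_append,
    ← concatPrefix_congr hfg] at eg
  set s := cfPoint fun i => concatSeq f ((k + 1) ^ 2 + i) with hs
  set t := cfPoint fun i => concatSeq g ((k + 1) ^ 2 + i) with ht
  have hsI : s ∈ Icc (0 : ℝ) 1 := cfPoint_mem_Icc fun i => hfp _
  have htI : t ∈ Icc (0 : ℝ) 1 := cfPoint_mem_Icc fun i => hgp _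
  have h1 := le_abs_cfVal_sub (cfVal_mem_Icc hsI (hf k).posWord) (cfVal_mem_Icc htI (hg k).posWord)
    hpos
  rw [← ef, ← eg] at h1
  have hH0 : (0 : ℝ) < (h : ℝ) ^ (k + 1) := by
    have : (0 : ℝ) < h := by exact_mod_cast hh
    positivity
  have h2 : 1 / ((h : ℝ) ^ (k + 1)) ^ 2 ≤ |cfVal s (f k) - cfVal t (g k)| := by
    obtain ⟨u, hu⟩ := (hf k).exists_eq
    obtain ⟨v, hv⟩ := (hg k).exists_eq
    have hlen : u.length = v.length := by
      have h3 := (hf k).length_eq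
      have h4 := (hg k).length_eq
      rw [hu, List.length_append] at h3
      rw [hv, List.length_append] at h4
      omega
    have h3 := (hf k).posWord
    have h4 := (hg k).posWord
    have h5 : (wordSize (f k) : ℝ) ≤ (h : ℝ) ^ (k + 1) := by exact_mod_cast (hf k).wordSize_le
    have h6 : (wordSize (g k) : ℝ) ≤ (h : ℝ) ^ (k + 1) := by exact_mod_cast (hg k).wordSize_le
    have h7 : (1 : ℝ) ≤ wordSize (f k) := by exact_mod_cast one_le_wordSize _
    have h8 : (1 : ℝ) ≤ wordSize (g k) := by exact_mod_cast one_le_wordSize _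
    have h9 := separation hsI htI hlen (fun e => hk (by rw [hu, hv, e]))
      (List.cons_ne_nil 1 []) (hu ▸ h3) (hv ▸ h4)
    rw [← hu, ← hv] at h9
    refine le_trans ?_ h9
    rw [sq]
    exact one_div_le_one_div_of_le (by positivity) (mul_le_mul h5 h6 (by positivity) hH0.le)
  set q : ℝ := ((contDen (concatPrefix f k) : ℕ) : ℝ) with hq
  have hq1 : 1 ≤ q := one_le_contDen hpos
  set H : ℝ := (h : ℝ) ^ (k + 1) with hH
  have hH1 : 1 ≤ H := one_le_pow₀ (by exact_mod_cast hh)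
  set d := |cfPoint (concatSeq f) - cfPoint (concatSeq g)| with hd
  have h3 : (4 * H ^ 2)⁻¹ * (q ^ 2)⁻¹ ≤ d := by
    refine le_trans (le_of_eq ?_) ((div_le_div_of_nonneg_right h2 (by positivity)).trans h1)
    field_simp
  have h4 : q ^ (-(2 * θ)) ≤ 4 * H ^ 2 * d ^ θ := by
    calc q ^ (-(2 * θ)) = 4 * H ^ 2 * ((4 * H ^ 2)⁻¹ ^ (1 : ℝ) * ((q ^ 2)⁻¹) ^ θ) := by
          rw [Real.rpow_one, ← mul_assoc, mul_inv_cancel₀ (by positivity), one_mul,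
            ← Real.rpow_natCast, ← Real.rpow_neg (by positivity), ← Real.rpow_mul (by positivity)]
          congr 1
          push_cast
          ring
      _ ≤ 4 * H ^ 2 * ((4 * H ^ 2)⁻¹ ^ θ * ((q ^ 2)⁻¹) ^ θ) := by
          gcongr 4 * H ^ 2 * (?_ * _)
          refine Real.rpow_le_rpow_of_exponent_ge (by positivity) ?_ hθ1
          exact inv_le_one_of_one_le₀ (by nlinarith)
      _ = 4 * H ^ 2 * ((4 * H ^ 2)⁻¹ * (q ^ 2)⁻¹) ^ θ := by
          rw [Real.mul_rpow (by positivity) (by positivity)]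
      _ ≤ 4 * H ^ 2 * d ^ θ := by gcongr
  calc wt θ (concatPrefix f k) ≤ ENNReal.ofReal (4 * H ^ 2 * d ^ θ) := ENNReal.ofReal_le_ofReal h4
    _ = _ := by
        rw [ENNReal.ofReal_mul (by positivity), ENNReal.ofReal_mul (by norm_num),
          ← ENNReal.ofReal_rpow_of_nonneg (abs_nonneg _) hθ, edist_dist, Real.dist_eq, hH,
          ENNReal.ofReal_pow (by positivity), ENNReal.ofReal_pow (by positivity),
          ENNReal.ofReal_natCast]
        simp

lemma exists_mul_pow_le_prod {R : ℝ≥0∞} (hR0 : R ≠ 0) (hR : R ≠ ∞) (k₀ : ℕ) (Z : ℕ → ℝ≥0∞)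
    (hZ0 : ∀ k, Z k ≠ 0) (hZ : ∀ k ≥ k₀, R ≤ Z k) :
    ∃ C ≠ 0, ∀ k, C * R ^ k ≤ ∏ j ∈ Finset.range k, Z j := by
  induction k₀ generalizing Z with
  | zero =>
    refine ⟨1, one_ne_zero, fun k => ?_⟩
    rw [one_mul]
    simpa using Finset.prod_le_prod' (s := Finset.range k) fun j _ => hZ j (Nat.zero_le j)
  | succ k₀ ih =>
    obtain ⟨C, hC0, hC⟩ := ih (fun k => Z (k + 1)) (fun k => hZ0 _) fun k hk => hZ _ (by omega)
    refine ⟨min 1 (C * Z 0 * R⁻¹), ?_, fun k => ?_⟩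
    · rw [ne_eq, min_eq_iff]
      simp [hC0, hZ0 0, hR]
    · cases k with
      | zero => simp
      | succ k =>
        rw [Finset.prod_range_succ']
        calc min 1 (C * Z 0 * R⁻¹) * R ^ (k + 1) ≤ C * Z 0 * R⁻¹ * R ^ (k + 1) :=
              mul_le_mul_left (min_le_right _ _) _
          _ = C * R ^ k * Z 0 * (R⁻¹ * R) := by ring
          _ = C * R ^ k * Z 0 := by rw [ENNReal.inv_mul_cancel hR0 hR, mul_one]
          _ ≤ _ := mul_le_mul_left (hC k) _

theorem le_dimH_of_isBlock {θ : ℝ} (hθ : 0 < θ) (hθ1 : θ ≤ 1) {h : ℕ} (hh : 2 ≤ h)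
    {S : ℕ → Set (List ℕ)} (hS : ∀ k, ∀ w ∈ S k, IsBlock h k w) (hne : ∀ k, (S k).Nonempty)
    (hfin : ∀ k, (S k).Finite) (hZ : ∀ᶠ k in atTop, 4 * (h : ℝ≥0∞) ^ 2 ≤ wsum θ (S k))
    {E : Set ℝ} (hE : ∀ f : ℕ → List ℕ, (∀ k, f k ∈ S k) → cfPoint (concatSeq f) ∈ E) :
    ENNReal.ofReal θ ≤ dimH E := by
  have hh0 : (h : ℝ≥0∞) ≠ 0 := by
    rw [Nat.cast_ne_zero]
    omega
  have hhtop : (h : ℝ≥0∞) ≠ ∞ := ENNReal.natCast_ne_top h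
  have hZ0 : ∀ k, wsum θ (S k) ≠ 0 := by
    intro k h0
    obtain ⟨w, hw⟩ := hne k
    have h1 := ENNReal.tsum_eq_zero.1 h0 ⟨w, hw⟩
    have h2 := one_le_contDen (hS k w hw).posWord
    rw [wt, ENNReal.ofReal_eq_zero] at h1
    have h3 : (0 : ℝ) < (contDen w : ℝ) ^ (-(2 * θ)) := by positivity
    linarith
  have hZtop : ∀ k, wsum θ (S k) ≠ ∞ := by
    intro k
    have := (hfin k).to_subtype
    have := Fintype.ofFinite (S k)
    rw [wsum, tsum_fintype]
    exact ENNReal.sum_ne_top.2 fun _ _ => ENNReal.ofReal_ne_top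
  obtain ⟨k₀, hk₀⟩ := eventually_atTop.1 hZ
  obtain ⟨C, hC0, hC⟩ := exists_mul_pow_le_prod (R := 4 * (h : ℝ≥0∞) ^ 2)
    (mul_ne_zero (by norm_num) (pow_ne_zero _ hh0)) (ENNReal.mul_ne_top (by norm_num)
      (ENNReal.pow_ne_top hhtop)) k₀ _ hZ0 hk₀
  have hCtop : C ≠ ∞ := by
    have := hC 0
    simp only [pow_zero, mul_one, Finset.range_zero, Finset.prod_empty] at this
    exact ne_top_of_le_ne_top ENNReal.one_ne_top this
  let : ∀ k, MeasurableSpace (S k) := fun _ => ⊤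
  let ν : ∀ k, MeasureTheory.Measure (S k) := fun k =>
    (PMF.normalize (fun w : S k => wt θ w) (hZ0 k) (hZtop k)).toMeasure
  have hν : ∀ k (w : S k), ν k {w} = wt θ w * (wsum θ (S k))⁻¹ := fun k w => by
    rw [PMF.toMeasure_apply_singleton _ _ MeasurableSpace.measurableSet_top]
    rfl
  let μ := MeasureTheory.Measure.infinitePi ν
  have hblock : ∀ ω : ∀ k, S k, ∀ k, IsBlock h k (ω k) := fun ω k => hS k _ (ω k).2
  have hcyl : ∀ (ω : ∀ k, S k) (k : ℕ), μ {ω' | ∀ j < k, ω' j = ω j} ≤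
      C⁻¹ * (((h : ℝ≥0∞) ^ 2) ^ k)⁻¹ * wt θ (concatPrefix (fun j => ω j) k) := by
    intro ω k
    have e : {ω' : ∀ k, S k | ∀ j < k, ω' j = ω j} =
        Set.pi (Finset.range k : Set ℕ) fun j => {ω j} := by
      ext ω'
      simp [Set.mem_pi]
    rw [e, MeasureTheory.Measure.infinitePi_pi _ fun _ _ => MeasurableSpace.measurableSet_top]
    simp_rw [hν]
    rw [Finset.prod_mul_distrib, ← ENNReal.prod_inv_distrib fun i _ j _ _ => Or.inl (hZ0 i)]
    calc _ ≤ 4 ^ k * wt θ (concatPrefix (fun j => ω j) k) * (C * (4 * (h : ℝ≥0∞) ^ 2) ^ k)⁻¹ :=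
          mul_le_mul' (prod_wt_le hθ.le hθ1 (fun j => (hblock ω j).posWord) k)
            (ENNReal.inv_le_inv.2 (hC k))
      _ = C⁻¹ * (((h : ℝ≥0∞) ^ 2) ^ k)⁻¹ * wt θ (concatPrefix (fun j => ω j) k) *
            (4 ^ k * (4 ^ k)⁻¹) := by
          rw [mul_pow, ENNReal.mul_inv (Or.inl hC0) (Or.inl hCtop),
            ENNReal.mul_inv (Or.inl (by simp)) (Or.inl (by simp))]
          ring
      _ = _ := by rw [ENNReal.mul_inv_cancel (by simp) (by simp), mul_one]
  let Φ : (∀ k, S k) → ℝ := fun ω => cfPoint (concatSeq fun k => ω k)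
  have hmass : ∀ U : Set ℝ, (Φ ⁻¹' U).Nonempty →
      μ (Φ ⁻¹' U) ≤ C⁻¹ * (4 * (h : ℝ≥0∞) ^ 2) * Metric.ediam U ^ θ := by
    rintro U ⟨ω, hω⟩
    by_cases hU : ∃ k, ∃ ω' ∈ Φ ⁻¹' U, ω' k ≠ ω k
    · classical
      obtain ⟨ω', hω', hne'⟩ := Nat.find_spec hU
      have hmin : ∀ ω' ∈ Φ ⁻¹' U, ∀ j < Nat.find hU, ω' j = ω j := fun ω' hω' j hj =>
        by_contra fun hne' => Nat.find_min hU hj ⟨ω', hω', hne'⟩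
      set k := Nat.find hU
      have h1 := wt_concatPrefix_le hθ.le hθ1 (one_le_two.trans hh) (hblock ω) (hblock ω') (k := k)
        (fun j hj => congrArg Subtype.val (hmin ω' hω' j hj).symm)
        fun e => hne' (Subtype.ext e.symm)
      have hk0 : ((h : ℝ≥0∞) ^ 2) ^ k ≠ 0 := pow_ne_zero _ (pow_ne_zero _ hh0)
      have hktop : ((h : ℝ≥0∞) ^ 2) ^ k ≠ ∞ := ENNReal.pow_ne_top (ENNReal.pow_ne_top hhtop)
      calc μ (Φ ⁻¹' U) ≤ μ {ω' | ∀ j < k, ω' j = ω j} := MeasureTheory.measure_mono hmin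
        _ ≤ C⁻¹ * (((h : ℝ≥0∞) ^ 2) ^ k)⁻¹ * wt θ (concatPrefix (fun j => ω j) k) := hcyl ω k
        _ ≤ C⁻¹ * (((h : ℝ≥0∞) ^ 2) ^ k)⁻¹ * (4 * ((h : ℝ≥0∞) ^ (k + 1)) ^ 2 *
              Metric.ediam U ^ θ) := by
            gcongr
            exact h1.trans (mul_le_mul_right
              (ENNReal.rpow_le_rpow
                (Metric.edist_le_ediam_of_mem (show Φ ω ∈ U from hω) hω') hθ.le) _)
        _ = C⁻¹ * (4 * (h : ℝ≥0∞) ^ 2) * Metric.ediam U ^ θ *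
              ((((h : ℝ≥0∞) ^ 2) ^ k)⁻¹ * ((h : ℝ≥0∞) ^ 2) ^ k) := by ring
        _ = _ := by rw [ENNReal.inv_mul_cancel hk0 hktop, mul_one]
    · push Not at hU
      have h0 : Tendsto (fun k : ℕ => C⁻¹ * (((h : ℝ≥0∞) ^ 2) ^ k)⁻¹) atTop (nhds 0) := by
        have h2 : ((h : ℝ≥0∞) ^ 2)⁻¹ < 1 := by
          rw [ENNReal.inv_lt_one]
          exact_mod_cast Nat.one_lt_pow two_ne_zero hh
        have := ENNReal.Tendsto.const_mul (a := C⁻¹)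
          (ENNReal.tendsto_pow_atTop_nhds_zero_of_lt_one h2) (Or.inr (ENNReal.inv_ne_top.2 hC0))
        simpa [ENNReal.inv_pow] using this
      refine (ge_of_tendsto' h0 fun k => ?_).trans zero_le
      refine (MeasureTheory.measure_mono (show Φ ⁻¹' U ⊆ {ω' | ∀ j < k, ω' j = ω j} from
        fun ω' hω' j _ => hU j ω' hω')).trans ((hcyl ω k).trans ?_)
      refine (mul_le_mul_right ?_ _).trans_eq (mul_one _)
      refine (wt_anti hθ.le (posWord_concatPrefix (fun j => (hblock ω j).posWord) k)).trans_eq ?_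
      simp [wt]
  have hH : MeasureTheory.Measure.hausdorffMeasure θ E ≠ 0 := by
    intro h0
    set D := C⁻¹ * (4 * (h : ℝ≥0∞) ^ 2) with hD
    have hDtop : D ≠ ∞ := ENNReal.mul_ne_top (ENNReal.inv_ne_top.2 hC0)
      (ENNReal.mul_ne_top (by simp) (ENNReal.pow_ne_top hhtop))
    have hD0 : D ≠ 0 := mul_ne_zero (ENNReal.inv_ne_zero.2 hCtop)
      (mul_ne_zero (by simp) (pow_ne_zero _ hh0))
    have h1 : (⨅ (t : ℕ → Set ℝ) (_ : E ⊆ ⋃ n, t n) (_ : ∀ n, Metric.ediam (t n) ≤ 1),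
        ∑' n, ⨆ _ : (t n).Nonempty, Metric.ediam (t n) ^ θ) = 0 := by
      rw [MeasureTheory.Measure.hausdorffMeasure_apply] at h0
      simpa using ENNReal.iSup_eq_zero.1 (ENNReal.iSup_eq_zero.1 h0 1) one_pos
    have h2 : D⁻¹ ≤ ⨅ (t : ℕ → Set ℝ) (_ : E ⊆ ⋃ n, t n) (_ : ∀ n, Metric.ediam (t n) ≤ 1),
        ∑' n, ⨆ _ : (t n).Nonempty, Metric.ediam (t n) ^ θ := by
      refine le_iInf fun t => le_iInf fun ht => le_iInf fun _ => ?_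
      rw [ENNReal.inv_le_iff_le_mul (fun _ => hD0) (fun h => absurd h hDtop)]
      have h3 : (univ : Set (∀ k, S k)) ⊆ ⋃ n, Φ ⁻¹' t n := by
        intro ω _
        rw [← preimage_iUnion]
        exact ht (hE _ fun k => (ω k).2)
      calc (1 : ℝ≥0∞) = μ univ := MeasureTheory.measure_univ.symm
        _ ≤ ∑' n, μ (Φ ⁻¹' t n) :=
          (MeasureTheory.measure_mono h3).trans (MeasureTheory.measure_iUnion_le _)
        _ ≤ ∑' n, D * ⨆ _ : (t n).Nonempty, Metric.ediam (t n) ^ θ := by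
          refine ENNReal.tsum_le_tsum fun n => ?_
          by_cases hn : (Φ ⁻¹' t n).Nonempty
          · have hn' : (t n).Nonempty := hn.elim fun ω hω => ⟨_, hω⟩
            rw [ciSup_pos hn']
            exact hmass _ hn
          · rw [not_nonempty_iff_eq_empty.1 hn, MeasureTheory.measure_empty]
            exact zero_le
        _ = _ := ENNReal.tsum_mul_left
    rw [h1, nonpos_iff_eq_zero, ENNReal.inv_eq_zero] at h2
    exact hDtop h2
  have : (θ.toNNReal : ℝ≥0∞) ≤ dimH E := by
    refine le_dimH_of_hausdorffMeasure_ne_zero ?_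
    rwa [Real.coe_toNNReal _ hθ.le]
  exact this

/-! ### Points of the level set -/

lemma cfPoint_mem_Lset {c : ℝ} (hc : 0 < c) {N : ℕ} (hN : 1 ≤ N) {f : ℕ → List ℕ}
    (hpos : ∀ k, PosWord (f k)) (hlast : ∀ k, (f k).getD (2 * k) 1 = 1)
    (hsnd : ∀ k, (f k).getD 1 1 = 1) (htail : ∀ k, ∀ e ≥ 1, (f k).getD e 1 ≤ N)
    (hhead : ∀ k : ℕ, ((f k).getD 0 1 : ℝ) ≤ max (N : ℝ) (Real.exp (c * k)))
    (hlow : ∀ᶠ k : ℕ in atTop, (1 - 1 / (k : ℝ)) * Real.exp (c * k) ≤ (f k).getD 0 1) :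
    cfPoint (concatSeq f) ∈ Lset fun n : ℕ => Real.exp (c * Nat.sqrt n) := by
  set a := concatSeq f with ha
  have ha1 : ∀ i, 1 ≤ a i := one_le_concatSeq hpos
  have hN' : (1 : ℝ) ≤ N := by exact_mod_cast hN
  have hNN : (N : ℝ) ≤ (N : ℝ) ^ 2 := by nlinarith
  have hprod : ∀ i : ℕ, ((a i * a (i + 1) : ℕ) : ℝ) ≤
      max ((N : ℝ) ^ 2) (Real.exp (c * Nat.sqrt (i + 1))) := by
    intro i
    set k := Nat.sqrt (i + 1) with hk
    have hk1 : 1 ≤ k := Nat.sqrt_pos.2 (Nat.succ_pos i)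
    obtain ⟨l, hl⟩ := Nat.exists_eq_add_of_le' hk1
    obtain ⟨e, he⟩ := Nat.exists_eq_add_of_le (Nat.sqrt_le' (i + 1))
    rw [← hk] at he
    have he2 : e ≤ 2 * k := by
      have h1 := Nat.lt_succ_sqrt' (i + 1)
      rw [← hk, Nat.succ_eq_add_one] at h1
      have h2 : (k + 1) ^ 2 = k ^ 2 + 2 * k + 1 := by ring
      omega
    have hsq : k ^ 2 = l ^ 2 + 2 * l + 1 := by rw [hl]; ring
    have hmax : ((f k).getD 0 1 : ℝ) ≤ max ((N : ℝ) ^ 2) (Real.exp (c * k)) :=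
      (hhead k).trans (max_le_max_right _ hNN)
    have hi1 : a (i + 1) = (f k).getD e 1 := by rw [he, ha, concatSeq_sq_add f (by omega)]
    rcases Nat.eq_zero_or_pos e with h0 | h0
    · have hi : a i = 1 := by
        rw [show i = l ^ 2 + 2 * l by omega, ha, concatSeq_sq_add f (by omega), hlast]
      rw [hi, hi1, h0, one_mul]
      exact hmax
    · have hi : a i = (f k).getD (e - 1) 1 := by
        rw [show i = k ^ 2 + (e - 1) by omega, ha, concatSeq_sq_add f (by omega)]
      rcases Nat.eq_or_lt_of_le (show 1 ≤ e from h0) with h1 | h1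
      · rw [hi, hi1, ← h1, hsnd, mul_one]
        exact hmax
      · refine le_trans ?_ (le_max_left _ _)
        rw [hi, hi1, sq]
        exact_mod_cast Nat.mul_le_mul (htail k _ (by omega)) (htail k _ (by omega))
  refine ⟨cfPoint_mem_Ioo ha1, irrational_cfPoint ha1, ?_⟩
  have hsqrt : Tendsto Nat.sqrt atTop atTop :=
    tendsto_atTop_atTop.2 fun b => ⟨b ^ 2, fun n hn => Nat.le_sqrt'.2 hn⟩
  have hexp : Tendsto (fun k : ℕ => Real.exp (c * k)) atTop atTop :=
    Real.tendsto_exp_atTop.comp (tendsto_natCast_atTop_atTop.const_mul_atTop hc)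
  have hlim : Tendsto (fun n : ℕ => 1 - 1 / (Nat.sqrt n : ℝ)) atTop (nhds 1) := by
    have h1 : Tendsto (fun k : ℕ => 1 - 1 / (k : ℝ)) atTop (nhds 1) := by
      simpa using tendsto_one_div_atTop_nhds_zero_nat.const_sub (1 : ℝ)
    exact h1.comp hsqrt
  refine tendsto_of_tendsto_of_tendsto_of_le_of_le' hlim tendsto_const_nhds ?_ ?_
  · filter_upwards [hsqrt.eventually hlow, eventually_ge_atTop 1] with n hn hn1
    set k := Nat.sqrt n with hk
    rw [le_div_iff₀ (Real.exp_pos _)]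
    refine hn.trans ?_
    have hk1 : 1 ≤ k := Nat.sqrt_pos.2 hn1
    obtain ⟨l, hl⟩ := Nat.exists_eq_add_of_le' (Nat.one_le_pow 2 k hk1)
    have h1 : pq (cfPoint a) (k ^ 2) * pq (cfPoint a) (k ^ 2 + 1) ≤ Lmax (cfPoint a) n :=
      Finset.le_sup (f := fun i => pq (cfPoint a) i * pq (cfPoint a) (i + 1))
        (Finset.mem_Icc.2 ⟨by omega, Nat.sqrt_le' n⟩)
    have h2 : pq (cfPoint a) (k ^ 2 + 1) = (f k).getD 0 1 := by
      rw [pq_cfPoint ha1, ha, ← concatSeq_sq_add f (by omega), add_zero]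
    have h3 : 1 ≤ pq (cfPoint a) (k ^ 2) := by
      rw [hl, pq_cfPoint ha1]
      exact ha1 l
    rw [h2] at h1
    exact_mod_cast (Nat.le_mul_of_pos_left _ h3).trans h1
  · filter_upwards [(hexp.comp hsqrt).eventually_ge_atTop ((N : ℝ) ^ 2)] with n hn
    rw [div_le_one (Real.exp_pos _)]
    rcases Nat.eq_zero_or_pos n with h0 | h0
    · subst h0
      simp [Lmax]
    obtain ⟨i, hi, hiL⟩ := Finset.exists_mem_eq_sup (Finset.Icc 1 n)
      ⟨1, Finset.mem_Icc.2 ⟨le_rfl, h0⟩⟩ fun i => pq (cfPoint a) i * pq (cfPoint a) (i + 1)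
    rw [Finset.mem_Icc] at hi
    rw [Lmax, hiL]
    obtain ⟨l, rfl⟩ := Nat.exists_eq_add_of_le' hi.1
    simp only [pq_cfPoint ha1]
    refine (hprod l).trans (max_le hn (Real.exp_le_exp.2 ?_))
    have : (Nat.sqrt (l + 1) : ℝ) ≤ Nat.sqrt n := by exact_mod_cast Nat.sqrt_le_sqrt hi.2
    exact mul_le_mul_of_nonneg_left this hc.le

/-! ### Blocks with large weight -/

lemma mul_wsum_le {θ : ℝ} (hθ : 0 ≤ θ) (hθ1 : θ ≤ 1) {ℓ : ℕ} {A B : Set (List ℕ)}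
    (hA : ∀ w ∈ A, PosWord w) (hAl : ∀ w ∈ A, w.length = ℓ) (hB : ∀ w ∈ B, PosWord w) :
    wsum θ A * wsum θ B ≤ 4 * wsum θ (image2 (· ++ ·) A B) := by
  let φ : A × B → image2 (· ++ ·) A B := fun p => ⟨p.1 ++ p.2, mem_image2_of_mem p.1.2 p.2.2⟩
  have hφ : Function.Injective φ := by
    rintro ⟨⟨u, hu⟩, ⟨v, hv⟩⟩ ⟨⟨u', hu'⟩, ⟨v', hv'⟩⟩ h
    obtain ⟨rfl, rfl⟩ := List.append_inj (Subtype.ext_iff.1 h) ((hAl u hu).trans (hAl u' hu').symm)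
    rfl
  calc wsum θ A * wsum θ B = ∑' p : A × B, wt θ p.1 * wt θ p.2 :=
        (tsum_prod_mul_eq_tsum_mul_tsum (fun w : A => wt θ w) fun w : B => wt θ w).symm
    _ ≤ ∑' p : A × B, 4 * wt θ (φ p) :=
        ENNReal.tsum_le_tsum fun p => wt_mul_le hθ hθ1 (hA _ p.1.2) (hB _ p.2.2)
    _ = 4 * ∑' p : A × B, wt θ (φ p) := ENNReal.tsum_mul_left
    _ ≤ _ := mul_le_mul_right (ENNReal.tsum_comp_le_tsum_of_injective hφ fun w => wt θ w) _

lemma wordSize_le_pow {N : ℕ} {w : List ℕ} (hw : ∀ a ∈ w, a ≤ N) :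
    wordSize w ≤ (N + 1) ^ w.length := by
  induction w with
  | nil => simp [wordSize]
  | cons a w ih =>
    rw [wordSize_cons, List.length_cons, pow_succ']
    exact Nat.mul_le_mul (Nat.succ_le_succ (hw a (by simp))) (ih fun b hb => hw b (by simp [hb]))

/-- Concatenations of `n` words of `F`. -/
def powWords (F : Set (List ℕ)) : ℕ → Set (List ℕ)
  | 0 => {[]}
  | n + 1 => image2 (· ++ ·) F (powWords F n)

lemma posWord_powWords {F : Set (List ℕ)} (hF : ∀ w ∈ F, PosWord w) (n : ℕ) :
    ∀ w ∈ powWords F n, PosWord w := by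
  induction n with
  | zero =>
    rintro _ rfl
    exact PosWord.nil
  | succ n ih => exact posWord_of_mem_image2 hF ih

lemma length_powWords {F : Set (List ℕ)} {m : ℕ} (hF : ∀ w ∈ F, w.length = m) (n : ℕ) :
    ∀ w ∈ powWords F n, w.length = m * n := by
  induction n with
  | zero =>
    rintro _ rfl
    rfl
  | succ n ih =>
    rintro _ ⟨u, hu, v, hv, rfl⟩
    simp only [List.length_append, hF u hu, ih v hv]
    ring

lemma le_of_mem_powWords {F : Set (List ℕ)} {N : ℕ} (hF : ∀ w ∈ F, ∀ a ∈ w, a ≤ N) (n : ℕ) :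
    ∀ w ∈ powWords F n, ∀ a ∈ w, a ≤ N := by
  induction n with
  | zero =>
    rintro _ rfl
    simp
  | succ n ih =>
    rintro _ ⟨u, hu, v, hv, rfl⟩ a ha
    exact (List.mem_append.1 ha).elim (hF u hu a) (ih v hv a)

lemma finite_powWords {F : Set (List ℕ)} (hF : F.Finite) (n : ℕ) : (powWords F n).Finite := by
  induction n with
  | zero => exact finite_singleton _
  | succ n ih => exact hF.image2 _ ih

lemma wsum_singleton (θ : ℝ) (w : List ℕ) : wsum θ {w} = wt θ w := by
  simp [wsum]

lemma wsum_pow_le {θ : ℝ} (hθ : 0 ≤ θ) (hθ1 : θ ≤ 1) {F : Set (List ℕ)} {m : ℕ}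
    (hF : ∀ w ∈ F, PosWord w) (hFl : ∀ w ∈ F, w.length = m) (n : ℕ) :
    wsum θ F ^ n ≤ 4 ^ n * wsum θ (powWords F n) := by
  induction n with
  | zero => simp [powWords, wsum_singleton, wt, contDen]
  | succ n ih =>
    calc wsum θ F ^ (n + 1) ≤ wsum θ F * (4 ^ n * wsum θ (powWords F n)) := by
          rw [pow_succ']
          exact mul_le_mul_right ih _
      _ = 4 ^ n * (wsum θ F * wsum θ (powWords F n)) := by ring
      _ ≤ 4 ^ n * (4 * wsum θ (powWords F (n + 1))) :=
          mul_le_mul_right (mul_wsum_le hθ hθ1 hF hFl (posWord_powWords hF n)) _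
      _ = _ := by ring

/-- Words `[A, 1]` with `A` slightly below `e^{ck}`. -/
def headWords (c : ℝ) (k : ℕ) : Set (List ℕ) :=
  {w | ∃ A : ℕ, 1 ≤ A ∧ (1 - 1 / (k : ℝ)) * Real.exp (c * k) ≤ A ∧ (A : ℝ) ≤ Real.exp (c * k) ∧
    w = [A, 1]}

lemma posWord_headWords {c : ℝ} {k : ℕ} : ∀ w ∈ headWords c k, PosWord w := by
  rintro _ ⟨A, hA, -, -, rfl⟩
  exact posWord_cons.2 ⟨hA, posWord_cons.2 ⟨le_rfl, PosWord.nil⟩⟩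

lemma finite_headWords (c : ℝ) (k : ℕ) : (headWords c k).Finite := by
  refine ((finite_le_nat ⌊Real.exp (c * k)⌋₊).image fun A => [A, 1]).subset ?_
  rintro _ ⟨A, -, -, h, rfl⟩
  exact ⟨A, Nat.le_floor h, rfl⟩

lemma le_wsum_headWords {c θ : ℝ} (hθ : 0 ≤ θ) (hθ1 : θ ≤ 1) {k : ℕ} (hk : 2 ≤ k)
    (hck : 2 * (k : ℝ) ≤ Real.exp (c * k)) :
    ENNReal.ofReal (Real.exp (c * k * (1 - 2 * θ)) / (8 * k)) ≤ wsum θ (headWords c k) := by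
  set M := Real.exp (c * k) with hM
  have hk' : (2 : ℝ) ≤ k := by exact_mod_cast hk
  have hM4 : 4 ≤ M := by linarith
  have hk2 : 1 / (k : ℝ) ≤ 1 / 2 := one_div_le_one_div_of_le two_pos hk'
  have hlow : 1 ≤ (1 - 1 / (k : ℝ)) * M := by nlinarith
  set s := Finset.Icc ⌈(1 - 1 / (k : ℝ)) * M⌉₊ ⌊M⌋₊ with hs
  let φ : s → headWords c k := fun A => ⟨[A.1, 1], A.1, by
    obtain ⟨h1, h2⟩ := Finset.mem_Icc.1 A.2
    rw [Nat.ceil_le] at h1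
    refine ⟨?_, h1, (Nat.le_floor_iff (by linarith)).1 h2, rfl⟩
    exact_mod_cast hlow.trans h1⟩
  have hφ : Function.Injective φ := by
    rintro ⟨A, hA⟩ ⟨B, hB⟩ h
    have := Subtype.ext_iff.1 h
    simp only [φ, List.cons.injEq, and_true] at this
    exact Subtype.ext this
  have hcard : M / (2 * k) ≤ (s.card : ℝ) := by
    have h1 : (⌈(1 - 1 / (k : ℝ)) * M⌉₊ : ℝ) < (1 - 1 / (k : ℝ)) * M + 1 :=
      Nat.ceil_lt_add_one (by linarith)
    have h2 : M < ⌊M⌋₊ + 1 := Nat.lt_floor_add_one M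
    have h3 : ((⌊M⌋₊ + 1 : ℕ) : ℝ) - (⌈(1 - 1 / (k : ℝ)) * M⌉₊ : ℝ) ≤ (s.card : ℝ) := by
      rw [hs, Nat.card_Icc, sub_le_iff_le_add]
      exact_mod_cast le_tsub_add
    push_cast at h3
    have h4 : 1 ≤ M / (2 * k) := by rwa [one_le_div (by positivity)]
    have h5 : 1 / (k : ℝ) * M = M / (2 * k) + M / (2 * k) := by field_simp; ring
    nlinarith
  have hwt : ∀ A ∈ s, ENNReal.ofReal (M ^ (-(2 * θ)) / 4) ≤ wt θ [A, 1] := by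
    intro A hA
    have h2 := (Nat.le_floor_iff (by linarith)).1 (Finset.mem_Icc.1 hA).2
    refine ENNReal.ofReal_le_ofReal ?_
    have h3 : ((contDen [A, 1] : ℕ) : ℝ) = A + 1 := by simp [contDen]
    rw [h3]
    calc M ^ (-(2 * θ)) / 4 = M ^ (-(2 * θ)) * 2 ^ (-2 : ℝ) := by
          rw [Real.rpow_neg zero_le_two]
          norm_num
          ring
      _ ≤ M ^ (-(2 * θ)) * 2 ^ (-(2 * θ)) := by
          gcongr
          · norm_num
          · linarith
      _ = (M * 2) ^ (-(2 * θ)) := (Real.mul_rpow (by linarith) zero_le_two).symm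
      _ ≤ ((A : ℝ) + 1) ^ (-(2 * θ)) :=
          Real.rpow_le_rpow_of_nonpos (by positivity) (by linarith) (by linarith)
  calc ENNReal.ofReal (Real.exp (c * k * (1 - 2 * θ)) / (8 * k))
      = ENNReal.ofReal (M / (2 * k) * (M ^ (-(2 * θ)) / 4)) := by
        congr 1
        rw [hM, ← Real.exp_mul, show c * k * (1 - 2 * θ) = c * k + c * k * -(2 * θ) by ring,
          Real.exp_add]
        field_simp
        ring
    _ ≤ ENNReal.ofReal (s.card * (M ^ (-(2 * θ)) / 4)) := by gcongr
    _ = s.card • ENNReal.ofReal (M ^ (-(2 * θ)) / 4) := by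
        rw [ENNReal.ofReal_mul (by positivity), ENNReal.ofReal_natCast, nsmul_eq_mul]
    _ ≤ ∑ A ∈ s, wt θ [A, 1] := Finset.card_nsmul_le_sum _ _ _ hwt
    _ = ∑' A : s, wt θ (φ A) := (Finset.tsum_subtype s fun A => wt θ [A, 1]).symm
    _ ≤ wsum θ (headWords c k) := ENNReal.tsum_comp_le_tsum_of_injective hφ fun w => wt θ w

/-- Words for the positions `k², …, (k+1)² - 1` made of a large letter and words of `F`. -/
def bigWords (c : ℝ) (F : Set (List ℕ)) (m k : ℕ) : Set (List ℕ) :=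
  image2 (· ++ ·) (headWords c k) (image2 (· ++ ·) (powWords F ((2 * k - 2) / m))
    {List.replicate ((2 * k - 2) % m + 1) 1})

lemma exists_of_mem_bigWords {c : ℝ} {F : Set (List ℕ)} {m N k : ℕ} (hN : 1 ≤ N) (hk : 1 ≤ k)
    (hF : ∀ w ∈ F, PosWord w) (hFl : ∀ w ∈ F, w.length = m) (hFN : ∀ w ∈ F, ∀ a ∈ w, a ≤ N)
    {w : List ℕ} (hw : w ∈ bigWords c F m k) :
    ∃ A v, w = A :: 1 :: (v ++ [1]) ∧ 1 ≤ A ∧ (1 - 1 / (k : ℝ)) * Real.exp (c * k) ≤ A ∧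
      (A : ℝ) ≤ Real.exp (c * k) ∧ v.length + 2 = 2 * k ∧ PosWord v ∧ ∀ a ∈ v, a ≤ N := by
  obtain ⟨_, ⟨A, hA, hA1, hA2, rfl⟩, _, ⟨u, hu, _, rfl, rfl⟩, rfl⟩ := hw
  refine ⟨A, u ++ List.replicate ((2 * k - 2) % m) 1, ?_, hA, hA1, hA2, ?_, ?_, ?_⟩
  · simp [List.replicate_succ']
  · rw [List.length_append, length_powWords hFl _ u hu, List.length_replicate, Nat.div_add_mod]
    omega
  · exact posWord_append.2 ⟨posWord_powWords hF _ u hu, posWord_replicate_one _⟩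
  · intro a ha
    rcases List.mem_append.1 ha with h | h
    · exact le_of_mem_powWords hFN _ u hu a h
    · rwa [List.eq_of_mem_replicate h]

lemma isBlock_of_mem_bigWords {c : ℝ} {F : Set (List ℕ)} {m N k h : ℕ} (hN : 1 ≤ N)
    (hk : 1 ≤ k) (hc : 0 < c)
    (hF : ∀ w ∈ F, PosWord w) (hFl : ∀ w ∈ F, w.length = m) (hFN : ∀ w ∈ F, ∀ a ∈ w, a ≤ N)
    (hh : 4 * Real.exp c * ((N : ℝ) + 1) ^ 2 ≤ h)
    {w : List ℕ} (hw : w ∈ bigWords c F m k) : IsBlock h k w := by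
  obtain ⟨A, v, rfl, hA, -, hA2, hl, hv, hvN⟩ := exists_of_mem_bigWords hN hk hF hFl hFN hw
  refine ⟨?_, ?_, ⟨A :: 1 :: v, rfl⟩, ?_⟩
  · simp
    omega
  · exact posWord_cons.2 ⟨hA, posWord_cons.2 ⟨le_rfl,
      posWord_append.2 ⟨hv, posWord_replicate_one 1⟩⟩⟩
  · have h1 : wordSize (1 :: (v ++ [1])) ≤ (N + 1) ^ (2 * k) := by
      refine (wordSize_le_pow (N := N) fun a ha => ?_).trans_eq ?_
      · rcases List.mem_cons.1 ha with rfl | ha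
        · exact hN
        · rcases List.mem_append.1 ha with ha | ha
          · exact hvN a ha
          · rwa [List.mem_singleton.1 ha]
      · congr 1
        simp
        omega
    have h2 : ((wordSize (1 :: (v ++ [1])) : ℕ) : ℝ) ≤ ((N : ℝ) + 1) ^ (2 * k) := by
      exact_mod_cast h1
    have h3 : ((wordSize (A :: 1 :: (v ++ [1])) : ℕ) : ℝ) ≤ (h : ℝ) ^ (k + 1) := by
      rw [wordSize_cons]
      push_cast
      have hM : 1 ≤ Real.exp (c * k) := Real.one_le_exp (by positivity)
      have hM' : Real.exp (c * k) = Real.exp c ^ k := by rw [← Real.exp_nat_mul, mul_comm]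
      have hh1 : (1 : ℝ) ≤ Real.exp c := Real.one_le_exp hc.le
      have hN2 : (1 : ℝ) ≤ ((N : ℝ) + 1) ^ 2 :=
          one_le_pow₀ (by linarith [Nat.cast_nonneg (α := ℝ) N])
      calc ((A : ℝ) + 1) * ((wordSize (1 :: (v ++ [1])) : ℕ) : ℝ)
          ≤ (4 * Real.exp (c * k)) * ((N : ℝ) + 1) ^ (2 * k) := by
            gcongr
            linarith
        _ = 4 * (Real.exp c * ((N : ℝ) + 1) ^ 2) ^ k := by
            rw [hM', mul_pow, pow_mul]
            ring
        _ ≤ h * (h : ℝ) ^ k := by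
            have h5 : 1 ≤ Real.exp c * ((N : ℝ) + 1) ^ 2 := one_le_mul_of_one_le_of_one_le hh1 hN2
            gcongr
            · nlinarith
            · nlinarith
        _ = (h : ℝ) ^ (k + 1) := (pow_succ' _ _).symm
    exact_mod_cast h3

lemma finite_bigWords {c : ℝ} {F : Set (List ℕ)} (hF : F.Finite) (m k : ℕ) :
    (bigWords c F m k).Finite :=
  (finite_headWords c k).image2 _ ((finite_powWords hF _).image2 _ (finite_singleton _))

lemma exists_finite_words {c θ₀ θ δ : ℝ} (hc : 0 < c) (hθ₁ : 1 / 2 < θ₀) (hθ : θ < θ₀)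
    (hδ : 0 < δ)
    (hP : Tendsto (fun n : ℕ => (1 / n : ℝ) *
        Real.log (∑' a : Fin n → ℕ+, (contDen (fnWord a) : ℝ) ^ (-(2 * θ₀))))
      atTop (nhds (c * (θ₀ - 1 / 2)))) :
    ∀ᶠ m : ℕ in atTop, ∃ F : Set (List ℕ), F.Finite ∧ (∀ w ∈ F, PosWord w) ∧
      (∀ w ∈ F, w.length = m) ∧
      ENNReal.ofReal (Real.exp (m * (c * (θ₀ - 1 / 2) - δ)) / 2) ≤ wsum θ F := by
  filter_upwards [pressure_bounds (mul_pos hc (by linarith)) hP hδ] with m ⟨hs, hm, _⟩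
  set b := Real.exp (m * (c * (θ₀ - 1 / 2) - δ)) with hb
  have hb0 : 0 < b := Real.exp_pos _
  obtain ⟨s, hs'⟩ := ((hs.hasSum.eventually (lt_mem_nhds
    (show b / 2 < _ by linarith)))).exists
  refine ⟨fnWord '' (s : Set (Fin m → ℕ+)), s.finite_toSet.image _, ?_, ?_, ?_⟩
  · rintro _ ⟨a, -, rfl⟩
    exact posWord_fnWord a
  · rintro _ ⟨a, -, rfl⟩
    simp [fnWord]
  · let φ : s → fnWord '' (s : Set (Fin m → ℕ+)) := fun a => ⟨fnWord a.1, a.1, a.2, rfl⟩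
    have hφ : Function.Injective φ := fun a b h =>
      Subtype.ext (fnWord_injective (Subtype.ext_iff.1 h))
    calc ENNReal.ofReal (b / 2)
        ≤ ENNReal.ofReal (∑ a ∈ s, (contDen (fnWord a) : ℝ) ^ (-(2 * θ₀))) :=
          ENNReal.ofReal_le_ofReal hs'.le
      _ = ∑ a ∈ s, wt θ₀ (fnWord a) := ENNReal.ofReal_sum_of_nonneg fun a _ => by positivity
      _ ≤ ∑ a ∈ s, wt θ (fnWord a) := Finset.sum_le_sum fun a _ => wt_anti hθ.le (posWord_fnWord a)
      _ = ∑' a : s, wt θ (φ a) := (Finset.tsum_subtype s fun a => wt θ (fnWord a)).symm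
      _ ≤ _ := ENNReal.tsum_comp_le_tsum_of_injective hφ fun w => wt θ w

lemma le_wsum_bigWords {c θ σ : ℝ} (hθ : 0 ≤ θ) (hθ1 : θ ≤ 1) (hσ : 0 ≤ σ)
    {F : Set (List ℕ)} {m k : ℕ} (hm : 1 ≤ m) (hF : ∀ w ∈ F, PosWord w)
    (hFl : ∀ w ∈ F, w.length = m) (hFw : ENNReal.ofReal (4 * Real.exp (m * σ)) ≤ wsum θ F)
    (hk : 2 ≤ k) (hck : 2 * (k : ℝ) ≤ Real.exp (c * k)) :
    ENNReal.ofReal (Real.exp ((c * (1 - 2 * θ) + 2 * σ) * k) / k *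
      (Real.exp (-((m + 2) * σ)) / (128 * 4 ^ m))) ≤ wsum θ (bigWords c F m k) := by
  set n := (2 * k - 2) / m with hn
  set r := (2 * k - 2) % m with hr
  have hrm : r + 1 ≤ m := Nat.mod_lt _ hm
  have hmn : m * n + r + 2 = 2 * k := by
    have : m * n + r = 2 * k - 2 := Nat.div_add_mod (2 * k - 2) m
    omega
  have hmn' : (2 : ℝ) * k - (m + 2) ≤ m * n := by
    have h1 : 2 * k ≤ m * n + (m + 2) := by omega
    have h2 : (2 : ℝ) * k ≤ m * n + (m + 2) := by exact_mod_cast h1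
    linarith
  set t := List.replicate (r + 1) 1 with ht
  have htp : PosWord t := posWord_replicate_one _
  have hwt : ENNReal.ofReal (1 / (4 : ℝ) ^ m) ≤ wt θ t := by
    refine ENNReal.ofReal_le_ofReal ?_
    have h1 : (contDen t : ℝ) ≤ 2 ^ m := by
      refine (contDen_le_wordSize htp).trans ?_
      have h2 := wordSize_le_pow (N := 1) (w := t) fun a ha => (List.eq_of_mem_replicate ha).le
      have h3 : wordSize t ≤ 2 ^ m := by
        refine h2.trans ?_
        rw [ht, List.length_replicate]
        exact Nat.pow_le_pow_right two_pos hrm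
      exact_mod_cast h3
    have h2 := one_le_contDen htp
    calc 1 / (4 : ℝ) ^ m = ((2 : ℝ) ^ m) ^ (-2 : ℝ) := by
          rw [Real.rpow_neg (by positivity), one_div, Real.rpow_ofNat, ← pow_mul, mul_comm m,
            pow_mul]
          norm_num
      _ ≤ (contDen t : ℝ) ^ (-2 : ℝ) :=
          Real.rpow_le_rpow_of_nonpos (by positivity) h1 (by norm_num)
      _ ≤ (contDen t : ℝ) ^ (-(2 * θ)) :=
          Real.rpow_le_rpow_of_exponent_le h2 (by linarith)
  have h4 : (4 : ℝ≥0∞) ^ n ≠ 0 := by simp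
  have h4' : (4 : ℝ≥0∞) ^ n ≠ ∞ := by simp
  have hpow : ENNReal.ofReal (Real.exp ((2 * k - (m + 2)) * σ)) ≤ wsum θ (powWords F n) := by
    rw [← ENNReal.mul_le_mul_iff_right h4 h4']
    refine le_trans ?_ (wsum_pow_le hθ hθ1 hF hFl n)
    refine le_trans ?_ (pow_le_pow_left' hFw n)
    rw [← ENNReal.ofReal_pow (by positivity), mul_pow, ← Real.exp_nat_mul,
      ENNReal.ofReal_mul (by positivity), ENNReal.ofReal_pow (by norm_num),
      ENNReal.ofReal_ofNat]
    refine mul_le_mul_right (ENNReal.ofReal_le_ofReal (Real.exp_le_exp.2 ?_)) _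
    nlinarith [mul_le_mul_of_nonneg_right hmn' hσ]
  have htail := mul_wsum_le hθ hθ1 (posWord_powWords hF n) (length_powWords hFl n)
    (B := {t}) (by rintro _ rfl; exact htp)
  have hhead := mul_wsum_le hθ hθ1 (posWord_headWords (c := c) (k := k)) (ℓ := 2)
    (by rintro _ ⟨A, -, -, -, rfl⟩; rfl)
    (posWord_of_mem_image2 (posWord_powWords hF n) (B := {t}) (by rintro _ rfl; exact htp))
  rw [wsum_singleton] at htail
  have hk0 : (0 : ℝ) < k := by
    have : 0 < k := by omega
    exact_mod_cast this
  have h16 : (16 : ℝ≥0∞) ≠ 0 := by simp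
  rw [← ENNReal.mul_le_mul_iff_right h16 (by simp)]
  calc 16 * ENNReal.ofReal (Real.exp ((c * (1 - 2 * θ) + 2 * σ) * k) / k *
        (Real.exp (-((m + 2) * σ)) / (128 * 4 ^ m)))
      = ENNReal.ofReal (Real.exp (c * k * (1 - 2 * θ)) / (8 * k)) *
        (ENNReal.ofReal (Real.exp ((2 * k - (m + 2)) * σ)) * ENNReal.ofReal (1 / (4 : ℝ) ^ m)) := by
        rw [← ENNReal.ofReal_mul (by positivity), ← ENNReal.ofReal_mul (by positivity),
          show (16 : ℝ≥0∞) = ENNReal.ofReal 16 by simp, ← ENNReal.ofReal_mul (by norm_num)]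
        congr 1
        rw [show (c * (1 - 2 * θ) + 2 * σ) * k = c * k * (1 - 2 * θ) + 2 * k * σ by ring,
          show (2 * k - (m + 2)) * σ = 2 * k * σ + -((m + 2) * σ) by ring, Real.exp_add,
          Real.exp_add]
        field_simp
        ring
    _ ≤ wsum θ (headWords c k) * (wsum θ (powWords F n) * wt θ t) :=
        mul_le_mul' (le_wsum_headWords hθ hθ1 hk hck) (mul_le_mul' hpow hwt)
    _ ≤ wsum θ (headWords c k) * (4 * wsum θ (image2 (· ++ ·) (powWords F n) {t})) :=
        mul_le_mul_right htail _
    _ = 4 * (wsum θ (headWords c k) * wsum θ (image2 (· ++ ·) (powWords F n) {t})) := by ring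
    _ ≤ 4 * (4 * wsum θ (bigWords c F m k)) := mul_le_mul_right hhead _
    _ = 16 * wsum θ (bigWords c F m k) := by
        rw [← mul_assoc]
        norm_num

lemma tendsto_wsum_bigWords {c θ σ : ℝ} (hc : 0 < c) (hθ : 0 ≤ θ) (hθ1 : θ ≤ 1) (hσ : 0 ≤ σ)
    (hβ : 0 < c * (1 - 2 * θ) + 2 * σ)
    {F : Set (List ℕ)} {m : ℕ} (hm : 1 ≤ m) (hF : ∀ w ∈ F, PosWord w)
    (hFl : ∀ w ∈ F, w.length = m) (hFw : ENNReal.ofReal (4 * Real.exp (m * σ)) ≤ wsum θ F) :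
    Tendsto (fun k => wsum θ (bigWords c F m k)) atTop (nhds ∞) := by
  have hexp : ∀ {b : ℝ}, 0 < b → Tendsto (fun k : ℕ => Real.exp (b * k) / (k : ℝ)) atTop atTop := by
    intro b hb
    have := (tendsto_exp_mul_div_rpow_atTop 1 b hb).comp (tendsto_natCast_atTop_atTop (R := ℝ))
    simpa [Function.comp_def] using this
  have h1 : Tendsto (fun k : ℕ => ENNReal.ofReal (Real.exp ((c * (1 - 2 * θ) + 2 * σ) * k) / k *
      (Real.exp (-((m + 2) * σ)) / (128 * 4 ^ m)))) atTop (nhds ∞) :=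
    ENNReal.tendsto_ofReal_atTop.comp ((hexp hβ).atTop_mul_const (by positivity))
  refine tendsto_nhds_top_mono h1 ?_
  filter_upwards [eventually_ge_atTop 2, (hexp hc).eventually_ge_atTop 2] with k hk hck
  have hk0 : (0 : ℝ) < k := by
    have : 0 < k := by omega
    exact_mod_cast this
  rw [le_div_iff₀ hk0] at hck
  exact le_wsum_bigWords hθ hθ1 hσ hm hF hFl hFw hk hck

theorem le_dimH_Lset {c θ₀ θ : ℝ} (hc : 0 < c) (hθ₁ : 1 / 2 < θ) (hθ : θ < θ₀) (hθ₂ : θ₀ < 1)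
    (hP : Tendsto (fun n : ℕ => (1 / n : ℝ) *
        Real.log (∑' a : Fin n → ℕ+, (contDen (fnWord a) : ℝ) ^ (-(2 * θ₀))))
      atTop (nhds (c * (θ₀ - 1 / 2)))) :
    ENNReal.ofReal θ ≤ dimH (Lset fun n : ℕ => Real.exp (c * Nat.sqrt n)) := by
  set δ := c * (θ₀ - θ) / 4 with hδ
  have hcθ : 0 < c * (θ₀ - θ) := mul_pos hc (by linarith)
  have hcθ' : 0 < c * (θ - 1 / 2) := mul_pos hc (by linarith)
  have hδ0 : 0 < δ := by linarith
  set σ := c * (θ₀ - 1 / 2) - 2 * δ with hσ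
  have hσ0 : 0 ≤ σ := by nlinarith
  have hβ : 0 < c * (1 - 2 * θ) + 2 * σ := by nlinarith
  have hm8 : Tendsto (fun m : ℕ => Real.exp (m * δ)) atTop atTop :=
    Real.tendsto_exp_atTop.comp (tendsto_natCast_atTop_atTop.atTop_mul_const hδ0)
  obtain ⟨m, ⟨F, hFfin, hF, hFl, hFw⟩, hm, hm8⟩ :=
    ((exists_finite_words hc (hθ₁.trans hθ) hθ hδ0 hP).and
      ((eventually_ge_atTop 1).and (hm8.eventually_ge_atTop 8))).exists
  have hFw' : ENNReal.ofReal (4 * Real.exp (m * σ)) ≤ wsum θ F := by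
    refine le_trans (ENNReal.ofReal_le_ofReal ?_) hFw
    rw [show (m : ℝ) * (c * (θ₀ - 1 / 2) - δ) = m * δ + m * σ by rw [hσ]; ring, Real.exp_add]
    nlinarith [Real.exp_pos (m * σ)]
  obtain ⟨N, hN1, hFN⟩ : ∃ N, 1 ≤ N ∧ ∀ w ∈ F, ∀ a ∈ w, a ≤ N := by
    obtain ⟨N, hN⟩ := (hFfin.biUnion fun w _ => w.finite_toSet).bddAbove
    exact ⟨N + 1, by omega, fun w hw a ha =>
      (hN (mem_biUnion hw ha)).trans (Nat.le_succ N)⟩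
  obtain ⟨h, hh⟩ := exists_nat_ge (4 * Real.exp c * ((N : ℝ) + 1) ^ 2)
  have hh4 : 4 ≤ h := by
    have h1 : (1 : ℝ) ≤ Real.exp c := Real.one_le_exp hc.le
    have h2 : (1 : ℝ) ≤ ((N : ℝ) + 1) ^ 2 :=
      one_le_pow₀ (by linarith [Nat.cast_nonneg (α := ℝ) N])
    have h3 : (4 : ℝ) ≤ h := by nlinarith [one_le_mul_of_one_le_of_one_le h1 h2]
    exact_mod_cast h3
  have hZ : ∀ᶠ k in atTop, 4 * (h : ℝ≥0∞) ^ 2 < wsum θ (bigWords c F m k) :=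
    (tendsto_wsum_bigWords hc (by linarith) (by linarith) hσ0 hβ hm hF hFl hFw').eventually
      (lt_mem_nhds (ENNReal.mul_lt_top (by simp) (by simp)))
  obtain ⟨k₀, hk₀⟩ := eventually_atTop.1 (hZ.and (eventually_ge_atTop 1))
  let S : ℕ → Set (List ℕ) := fun k =>
    if k₀ ≤ k then bigWords c F m k else {List.replicate (2 * k + 1) 1}
  have hSblock : ∀ k, ∀ w ∈ S k, IsBlock h k w := by
    intro k w hw
    by_cases hk : k₀ ≤ k
    · simp only [S, hk, if_true] at hw
      exact isBlock_of_mem_bigWords hN1 (hk₀ k hk).2 hc hF hFl hFN hh hw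
    · simp only [S, hk, if_false, mem_singleton_iff] at hw
      subst hw
      refine ⟨List.length_replicate, posWord_replicate_one _, ⟨List.replicate (2 * k) 1, ?_⟩, ?_⟩
      · exact List.replicate_succ'
      · refine (wordSize_le_pow (N := 1) fun a ha => (List.eq_of_mem_replicate ha).le).trans ?_
        rw [List.length_replicate]
        calc 2 ^ (2 * k + 1) ≤ 2 ^ (2 * (k + 1)) := Nat.pow_le_pow_right two_pos (by omega)
          _ = 4 ^ (k + 1) := by rw [pow_mul]; norm_num
          _ ≤ h ^ (k + 1) := Nat.pow_le_pow_left hh4 _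
  have hSform : ∀ k, ∀ w ∈ S k, w.getD (2 * k) 1 = 1 ∧ w.getD 1 1 = 1 ∧
      (∀ e ≥ 1, w.getD e 1 ≤ N) ∧ (w.getD 0 1 : ℝ) ≤ max (N : ℝ) (Real.exp (c * k)) ∧
      (k₀ ≤ k → (1 - 1 / (k : ℝ)) * Real.exp (c * k) ≤ w.getD 0 1) := by
    intro k w hw
    by_cases hk : k₀ ≤ k
    · simp only [S, hk, if_true] at hw
      obtain ⟨A, v, rfl, -, hA1, hA2, hl, -, hvN⟩ :=
        exists_of_mem_bigWords hN1 (hk₀ k hk).2 hF hFl hFN hw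
      refine ⟨?_, rfl, ?_, hA2.trans (le_max_right _ _), fun _ => hA1⟩
      · rw [← hl]
        simp
      · intro e he
        obtain ⟨e, rfl⟩ := Nat.exists_eq_add_of_le' he
        rw [List.getD_cons_succ]
        rcases lt_or_ge e (1 :: (v ++ [1])).length with h1 | h1
        · rw [List.getD_eq_getElem _ _ h1]
          have h2 := List.getElem_mem h1
          rcases List.mem_cons.1 h2 with h2 | h2
          · rwa [h2]
          · rcases List.mem_append.1 h2 with h2 | h2
            · exact hvN _ h2
            · rwa [List.mem_singleton.1 h2]
        · rwa [List.getD_eq_default _ _ h1]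
    · simp only [S, hk, if_false, mem_singleton_iff] at hw
      subst hw
      have h1 : ∀ e, (List.replicate (2 * k + 1) 1).getD e 1 = 1 := fun e => by
        rw [List.getD_eq_getElem?_getD, List.getElem?_replicate]
        split_ifs <;> rfl
      refine ⟨h1 _, h1 _, fun e _ => by rwa [h1], ?_, fun h2 => absurd h2 hk⟩
      rw [h1]
      exact le_max_of_le_left (by exact_mod_cast hN1)
  refine le_dimH_of_isBlock (by linarith) (by linarith) (by omega) hSblock (fun k => ?_)
    (fun k => ?_) ?_ (S := S) fun f hf => ?_
  · by_cases hk : k₀ ≤ k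
    · simp only [S, hk, if_true]
      by_contra hne
      have h1 := (hk₀ k hk).1
      rw [not_nonempty_iff_eq_empty.1 hne] at h1
      simp [wsum] at h1
    · simp [S, hk]
  · by_cases hk : k₀ ≤ k
    · simpa only [S, hk, if_true] using finite_bigWords hFfin m k
    · simp [S, hk]
  · filter_upwards [eventually_ge_atTop k₀] with k hk
    simpa only [S, hk, if_true] using (hk₀ k hk).1.le
  · refine cfPoint_mem_Lset hc hN1 (fun k => (hSblock k _ (hf k)).posWord)
      (fun k => (hSform k _ (hf k)).1) (fun k => (hSform k _ (hf k)).2.1)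
      (fun k => (hSform k _ (hf k)).2.2.1) (fun k => (hSform k _ (hf k)).2.2.2.1) ?_
    filter_upwards [eventually_ge_atTop k₀] with k hk
    exact (hSform k _ (hf k)).2.2.2.2 hk

/-- Theorem 1.4: for `ψ(n) = e^{c⌊√n⌋}`, `dim_H L(ψ) = θ₀` where `θ₀` solves the
pressure equation `P(θ₀) = c (θ₀ - 1/2)`. -/
theorem statement5 (c : ℝ) (hc : 0 < c) (θ₀ : ℝ) (hθ₁ : 1 / 2 < θ₀) (hθ₂ : θ₀ < 1)
    (hP : Tendsto (fun n : ℕ => (1 / n : ℝ) *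
        Real.log (∑' a : Fin n → ℕ+,
          ((contDen (List.ofFn fun i => ((a i : ℕ))) : ℝ) ^ (-(2 * θ₀)))))
      atTop (nhds (c * (θ₀ - 1 / 2)))) :
    dimH (Lset fun n : ℕ => Real.exp (c * Nat.sqrt n)) = ENNReal.ofReal θ₀ := by
  have hcont : Tendsto ENNReal.ofReal (nhds θ₀) (nhds (ENNReal.ofReal θ₀)) :=
    ENNReal.continuous_ofReal.tendsto θ₀
  refine le_antisymm ?_ ?_
  · refine ge_of_tendsto
      (hcont.mono_left nhdsWithin_le_nhds : Tendsto _ (nhdsWithin θ₀ (Ioi θ₀)) _) ?_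
    filter_upwards [self_mem_nhdsWithin] with θ hθ
    exact dimH_Lset_le hc hθ₁ hθ hP
  · refine le_of_tendsto
      (hcont.mono_left nhdsWithin_le_nhds : Tendsto _ (nhdsWithin θ₀ (Iio θ₀)) _) ?_
    filter_upwards [Ioo_mem_nhdsLT hθ₁] with θ hθ
    exact le_dimH_Lset hc hθ.1 hθ.2 hθ₂ hP
end

section
/- Let φ : ℝ⁺ → ℝ⁺ be an increasing function such that log φ is a regularly increasing function with index ρ, where 0 ≤ ρ < 1/2. Let E be the set of all irrational x ∈ (0,1) such that ⌊φ(k²)⌋ ≤ a_{k²}(x) ≤ (1 + 1/k)·⌊φ(k²)⌋ for every k ≥ 1, and a_i(x) = 1 for every index i that is not a perfect square. Then E ⊆ L(φ). -/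
open Filter Set
open scoped ENNReal

/-- A regularly increasing function of index `ρ` eventually grows no faster than `x ^ β`, for
every `β > ρ`. -/
lemma RegInc.exists_le_mul_rpow {f : ℝ → ℝ} {ρ β : ℝ} (h : RegInc f ρ) (hβ : ρ < β) :
    ∃ x₀ ≥ (1 : ℝ), ∀ x ≥ x₀, 0 < f x ∧ ∀ y ≥ x, f y ≤ f x * (y / x) ^ β := by
  obtain ⟨c, -, f', hpos, hder, -, -, -, hlim⟩ := h
  obtain ⟨a, ha⟩ := eventually_atTop.1 (hlim.eventually_lt_const hβ)
  let x₀ := max (max a c) 1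
  have hx₀ : ∀ x ≥ x₀, a ≤ x ∧ c ≤ x ∧ 1 ≤ x := fun x hx =>
    ⟨((le_max_left _ _).trans (le_max_left _ _)).trans hx,
      ((le_max_right _ _).trans (le_max_left _ _)).trans hx, (le_max_right _ _).trans hx⟩
  have hd : ∀ x ≥ x₀, HasDerivAt (fun x => Real.log (f x) - β * Real.log x)
      (f' x / f x - β * x⁻¹) x := fun x hx => by
    obtain ⟨-, h2, h3⟩ := hx₀ x hx
    exact ((hder x h2).log (hpos x h2).ne').sub
      ((Real.hasDerivAt_log (by positivity)).const_mul β)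
  have hanti : AntitoneOn (fun x => Real.log (f x) - β * Real.log x) (Ici x₀) := by
    refine antitoneOn_of_deriv_nonpos (convex_Ici _)
      (fun x hx => (hd x hx).continuousAt.continuousWithinAt)
      (fun x hx => (hd x (interior_subset hx)).differentiableAt.differentiableWithinAt)
      fun x hx => ?_
    have hx' : x₀ ≤ x := interior_subset (s := Ici x₀) hx
    rw [(hd x hx').deriv]
    obtain ⟨h1, h2, h3⟩ := hx₀ x hx'
    have hx0 : 0 < x := by positivity
    have key : f' x / f x < β / x := by
      rw [lt_div_iff₀ hx0]
      calc f' x / f x * x = x * f' x / f x := by ring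
        _ < β := ha x h1
    rw [div_eq_mul_inv β] at key
    linarith
  refine ⟨x₀, le_max_right _ _, fun x hx => ?_⟩
  obtain ⟨-, h2, h3⟩ := hx₀ x hx
  refine ⟨hpos x h2, fun y hy => ?_⟩
  have hx0 : 0 < x := by positivity
  have hy0 : 0 < y := hx0.trans_le hy
  have hfx := hpos x h2
  have hfy := hpos y (h2.trans hy)
  have hpow : 0 < (y / x) ^ β := Real.rpow_pos_of_pos (div_pos hy0 hx0) β
  rw [← Real.log_le_log_iff hfy (mul_pos hfx hpow), Real.log_mul hfx.ne' hpow.ne',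
    Real.log_rpow (div_pos hy0 hx0), Real.log_div hy0.ne' hx0.ne']
  have := hanti (mem_Ici.2 hx) (mem_Ici.2 (hx.trans hy)) hy
  simp only at this
  linarith

/-- Over consecutive squares, the increments of a regularly increasing function of index less than
`1 / 2` are eventually bounded by a null sequence. -/
lemma RegInc.exists_sub_le {f : ℝ → ℝ} {ρ : ℝ} (h : RegInc f ρ) (hρ0 : 0 ≤ ρ)
    (hρ : ρ < 1 / 2) : ∃ u : ℕ → ℝ, Tendsto u atTop (nhds 0) ∧
      ∀ᶠ k : ℕ in atTop, f (((k : ℝ) + 1) ^ 2) - f ((k : ℝ) ^ 2) ≤ u k := by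
  obtain ⟨β, hβ1, hβ2⟩ := exists_between hρ
  obtain ⟨x₀, hx₀, hf⟩ := h.exists_le_mul_rpow hβ1
  have hx₀0 : 0 < x₀ := by positivity
  have hβ0 : 0 ≤ β := hρ0.trans hβ1.le
  refine ⟨fun k => f x₀ / x₀ ^ β * (k : ℝ) ^ (-(1 - 2 * β)), ?_, ?_⟩
  · have := ((tendsto_rpow_neg_atTop (show 0 < 1 - 2 * β by linarith)).comp
      tendsto_natCast_atTop_atTop).const_mul (f x₀ / x₀ ^ β)
    simpa using this
  · filter_upwards [eventually_ge_atTop ⌈x₀⌉₊] with k hk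
    have hk' : x₀ ≤ k := Nat.ceil_le.1 hk
    have hk1 : (1 : ℝ) ≤ k := hx₀.trans hk'
    have hk0 : (0 : ℝ) < k := by positivity
    have hkx : x₀ ≤ (k : ℝ) ^ 2 := by nlinarith
    obtain ⟨hpos, hstep⟩ := hf _ hkx
    have h1 := hstep (((k : ℝ) + 1) ^ 2) (by nlinarith)
    have h2 := (hf x₀ le_rfl).2 _ hkx
    have h3 : (((k : ℝ) + 1) ^ 2 / (k : ℝ) ^ 2) ^ β ≤ 1 + 1 / k := by
      have e : ((k : ℝ) + 1) ^ 2 / (k : ℝ) ^ 2 = (1 + 1 / (k : ℝ)) ^ (2 : ℝ) := by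
        rw [Real.rpow_two]; field_simp
      have hk1' : 1 ≤ 1 + 1 / (k : ℝ) := by simp
      rw [e, ← Real.rpow_mul (by positivity)]
      exact (Real.rpow_le_rpow_of_exponent_le hk1' (by linarith)).trans (Real.rpow_one _).le
    have h4 : (((k : ℝ) ^ 2) / x₀) ^ β / k = (k : ℝ) ^ (-(1 - 2 * β)) / x₀ ^ β := by
      rw [Real.div_rpow (by positivity) hx₀0.le, ← Real.rpow_two, ← Real.rpow_mul hk0.le,
        div_right_comm, ← Real.rpow_sub_one hk0.ne']
      ring_nf
    calc f (((k : ℝ) + 1) ^ 2) - f ((k : ℝ) ^ 2)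
        ≤ f ((k : ℝ) ^ 2) * (1 + 1 / k) - f ((k : ℝ) ^ 2) := by
          gcongr
          exact h1.trans (by gcongr)
      _ = f ((k : ℝ) ^ 2) / k := by ring
      _ ≤ f x₀ * ((k : ℝ) ^ 2 / x₀) ^ β / k := by gcongr
      _ = f x₀ / x₀ ^ β * (k : ℝ) ^ (-(1 - 2 * β)) := by
          rw [mul_div_assoc, h4]; ring

/-- If `log φ` is regularly increasing of index less than `1 / 2`, then `φ` is asymptotically
constant over consecutive squares. -/
lemma tendsto_ratio_squares {φ : ℝ → ℝ} {ρ : ℝ} (hφpos : ∀ x > (0 : ℝ), 0 < φ x)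
    (hφmono : MonotoneOn φ (Ioi (0 : ℝ))) (hρ0 : 0 ≤ ρ) (hρ : ρ < 1 / 2)
    (hreg : RegInc (fun x => Real.log (φ x)) ρ) :
    Tendsto (fun k : ℕ => φ (((k : ℝ) + 1) ^ 2) / φ ((k : ℝ) ^ 2)) atTop (nhds 1) := by
  obtain ⟨u, hu, hle⟩ := hreg.exists_sub_le hρ0 hρ
  have hu' : Tendsto (fun k => Real.exp (u k)) atTop (nhds 1) := by
    simpa [Function.comp_def] using (Real.continuous_exp.tendsto 0).comp hu
  refine tendsto_of_tendsto_of_tendsto_of_le_of_le' tendsto_const_nhds hu' ?_ ?_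
  · filter_upwards [eventually_ge_atTop 1] with k hk
    have hk0 : (0 : ℝ) < k := by exact_mod_cast hk
    have hp : (0 : ℝ) < (k : ℝ) ^ 2 := by positivity
    rw [one_le_div (hφpos _ hp)]
    exact hφmono hp (by positivity : (0 : ℝ) < ((k : ℝ) + 1) ^ 2) (by nlinarith)
  · filter_upwards [eventually_ge_atTop 1, hle] with k hk hk'
    have hk0 : (0 : ℝ) < k := by exact_mod_cast hk
    have h1 := hφpos ((k : ℝ) ^ 2) (by positivity)
    have h2 := hφpos (((k : ℝ) + 1) ^ 2) (by positivity)
    rw [← Real.log_le_iff_le_exp (div_pos h2 h1), Real.log_div h2.ne' h1.ne']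
    exact hk'

/-- Consecutive positive integers are not both perfect squares. -/
lemma not_exists_succ_sq {k : ℕ} (hk : 1 ≤ k) : ¬∃ j : ℕ, k ^ 2 + 1 = j ^ 2 := by
  rintro ⟨j, hj⟩
  rcases le_or_gt j k with h | h
  · nlinarith
  · have : k + 1 ≤ j := h
    nlinarith

/-- If all partial quotients off the perfect squares are `1`, then every product of consecutive
partial quotients is `1` or a partial quotient whose index is a perfect square. -/
lemma pq_mul_pq_succ {x : ℝ} (hone : ∀ i : ℕ, 1 ≤ i → (¬∃ k : ℕ, i = k ^ 2) → pq x i = 1)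
    {i : ℕ} (hi : 1 ≤ i) :
    pq x i * pq x (i + 1) = 1 ∨
      ∃ k : ℕ, k ^ 2 ≤ i + 1 ∧ 1 ≤ k ∧ pq x i * pq x (i + 1) = pq x (k ^ 2) := by
  by_cases h : ∃ k : ℕ, i = k ^ 2
  · obtain ⟨k, rfl⟩ := h
    have hk : 1 ≤ k := Nat.one_le_iff_ne_zero.2 (by rintro rfl; simp at hi)
    exact .inr ⟨k, by omega, hk, by rw [hone _ (by omega) (not_exists_succ_sq hk), mul_one]⟩
  · rw [hone i hi h, one_mul]
    by_cases h' : ∃ k : ℕ, i + 1 = k ^ 2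
    · obtain ⟨k, hk⟩ := h'
      have hk1 : 1 ≤ k := Nat.one_le_iff_ne_zero.2 (by rintro rfl; simp at hk)
      exact .inr ⟨k, hk.ge, hk1, by rw [hk]⟩
    · exact .inl (hone _ (by omega) h')

/-- Proposition 3.1: the Cantor-type set with `⌊φ(k²)⌋ ≤ a_{k²}(x) ≤ (1+1/k)⌊φ(k²)⌋`
and `a_i(x) = 1` off perfect squares is contained in `L(φ)`. -/
theorem statement6 (φ : ℝ → ℝ) (ρ : ℝ)
    (hφpos : ∀ x > (0 : ℝ), 0 < φ x)
    (hφmono : MonotoneOn φ (Ioi (0 : ℝ)))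
    (hρ0 : 0 ≤ ρ) (hρ : ρ < 1 / 2)
    (hreg : RegInc (fun x => Real.log (φ x)) ρ) :
    {x : ℝ | x ∈ Ioo (0 : ℝ) 1 ∧ Irrational x ∧
      (∀ k : ℕ, 1 ≤ k →
        (⌊φ ((k : ℝ) ^ 2)⌋₊ ≤ pq x (k ^ 2) ∧
          (pq x (k ^ 2) : ℝ) ≤ (1 + 1 / k) * ⌊φ ((k : ℝ) ^ 2)⌋₊)) ∧
      (∀ i : ℕ, 1 ≤ i → (¬∃ k : ℕ, i = k ^ 2) → pq x i = 1)}
      ⊆ Lset fun n : ℕ => φ n := by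
  rintro x ⟨hx, hirr, ha, hone⟩
  refine ⟨hx, hirr, ?_⟩
  have hratio := tendsto_ratio_squares hφpos hφmono hρ0 hρ hreg
  have hφtop : Tendsto φ atTop atTop := by
    obtain ⟨c, hc, f', -, -, -, -, hlim, -⟩ := hreg
    refine (Real.tendsto_exp_atTop.comp hlim).congr' ?_
    filter_upwards [eventually_gt_atTop 0] with y hy
    exact Real.exp_log (hφpos y hy)
  have hsq : Tendsto (fun k : ℕ => (k : ℝ) ^ 2) atTop atTop :=
    (tendsto_pow_atTop two_ne_zero).comp tendsto_natCast_atTop_atTop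
  have hpos : ∀ k : ℕ, 1 ≤ k → 0 < φ k := fun k hk => hφpos _ (by exact_mod_cast hk)
  have hmono : ∀ k l : ℕ, 1 ≤ k → k ≤ l → φ k ≤ φ l := fun k l hk hl =>
    hφmono (show (0 : ℝ) < k by exact_mod_cast hk)
      (show (0 : ℝ) < l by exact_mod_cast hk.trans hl) (by exact_mod_cast hl)
  have hpq : Tendsto (fun k : ℕ => (pq x (k ^ 2) : ℝ) / φ ((k : ℝ) ^ 2)) atTop (nhds 1) := by
    have hfloor : Tendsto (fun k : ℕ => (⌊φ ((k : ℝ) ^ 2)⌋₊ : ℝ) / φ ((k : ℝ) ^ 2)) atTop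
        (nhds 1) := (tendsto_nat_floor_div_atTop (R := ℝ)).comp (hφtop.comp hsq)
    have hupper := (tendsto_one_div_atTop_nhds_zero_nat (𝕜 := ℝ)).const_add 1 |>.mul hfloor
    rw [add_zero, mul_one] at hupper
    refine tendsto_of_tendsto_of_tendsto_of_le_of_le' hfloor hupper ?_ ?_
    all_goals
      filter_upwards [eventually_ge_atTop 1] with k hk
      have hk0 : (0 : ℝ) < k := by exact_mod_cast hk
      have hp := hφpos ((k : ℝ) ^ 2) (by positivity)
      obtain ⟨h1, h2⟩ := ha k hk
    · have h1' : (⌊φ ((k : ℝ) ^ 2)⌋₊ : ℝ) ≤ pq x (k ^ 2) := by exact_mod_cast h1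
      gcongr
    · rw [← mul_div_assoc]
      gcongr
  have hlow : Tendsto (fun k : ℕ => (pq x (k ^ 2) : ℝ) / φ (((k : ℝ) + 1) ^ 2)) atTop
      (nhds 1) := by
    have := hpq.div hratio one_ne_zero
    rw [div_one] at this
    refine this.congr' ?_
    filter_upwards [eventually_ge_atTop 1] with k hk
    have hk0 : (0 : ℝ) < k := by exact_mod_cast hk
    have hp := hφpos ((k : ℝ) ^ 2) (by positivity)
    simp only [Pi.div_apply]
    field_simp
  have hup : Tendsto (fun k : ℕ => (pq x ((k + 1) ^ 2) : ℝ) / φ ((k : ℝ) ^ 2)) atTop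
      (nhds 1) := by
    have := (hpq.comp (tendsto_add_atTop_nat 1)).mul hratio
    rw [one_mul] at this
    refine this.congr fun k => ?_
    have hp := hφpos (((k : ℝ) + 1) ^ 2) (by positivity)
    simp only [Function.comp_apply, Nat.cast_add, Nat.cast_one]
    field_simp
  have hsqrt : Tendsto Nat.sqrt atTop atTop :=
    tendsto_atTop_atTop.2 fun b => ⟨b * b, fun n hn => Nat.le_sqrt.2 hn⟩
  refine tendsto_order.2 ⟨fun r hr => ?_, fun r hr => ?_⟩
  · filter_upwards [(hlow.comp hsqrt).eventually_const_lt hr, eventually_ge_atTop 1] with n hn hn1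
    refine hn.trans_le ?_
    have hs1 : 1 ≤ n.sqrt := Nat.le_sqrt.2 (by simpa using hn1)
    have hs : n.sqrt ^ 2 ≤ n := Nat.sqrt_le' n
    have hL : pq x (n.sqrt ^ 2) ≤ Lmax x n := by
      have : pq x (n.sqrt ^ 2) * pq x (n.sqrt ^ 2 + 1) ≤ Lmax x n :=
        Finset.le_sup (f := fun i => pq x i * pq x (i + 1))
          (Finset.mem_Icc.2 ⟨Nat.one_le_pow _ _ hs1, hs⟩)
      rwa [hone _ (by omega) (not_exists_succ_sq hs1), mul_one] at this
    have hφle : φ n ≤ φ (((n.sqrt : ℝ) + 1) ^ 2) := by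
      have := hmono n ((n.sqrt + 1) ^ 2) hn1 (Nat.lt_succ_sqrt' n).le
      push_cast at this
      exact this
    have := hpos n hn1
    simp only [Function.comp_apply]
    gcongr
  · obtain ⟨s, hs1, hsr⟩ := exists_between hr
    obtain ⟨K, hK⟩ := eventually_atTop.1 (hup.eventually_lt_const hs1)
    let M : ℝ := 1 + ∑ k ∈ Finset.range (K + 2), (pq x (k ^ 2) : ℝ)
    have hsum : ∀ k < K + 2, (pq x (k ^ 2) : ℝ) ≤
        ∑ k ∈ Finset.range (K + 2), (pq x (k ^ 2) : ℝ) := fun k hk =>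
      Finset.single_le_sum (f := fun k => (pq x (k ^ 2) : ℝ)) (fun _ _ => Nat.cast_nonneg _)
        (Finset.mem_range.2 hk)
    filter_upwards [(hφtop.comp tendsto_natCast_atTop_atTop).eventually_ge_atTop M,
      eventually_ge_atTop 1] with n hnM hn1
    have hφn := hpos n hn1
    simp only [Function.comp_apply] at hnM
    have hMn : φ n ≤ s * φ n := by nlinarith
    refine lt_of_le_of_lt ?_ hsr
    rw [div_le_iff₀ hφn]
    obtain ⟨i, hi, hiL⟩ := Finset.exists_mem_eq_sup (Finset.Icc 1 n) ⟨1, by simpa using hn1⟩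
      fun i => pq x i * pq x (i + 1)
    rw [Lmax, hiL]
    obtain ⟨hi1, hin⟩ := Finset.mem_Icc.1 hi
    rcases pq_mul_pq_succ hone hi1 with h | ⟨k, hk, hk1, h⟩
    · rw [h, Nat.cast_one]
      have : (1 : ℝ) ≤ M := le_add_of_nonneg_right (Finset.sum_nonneg fun _ _ => Nat.cast_nonneg _)
      linarith
    · rw [h]
      rcases lt_or_ge k (K + 2) with hkK | hkK
      · have := hsum k hkK
        linarith
      · obtain ⟨j, rfl⟩ := Nat.exists_eq_add_of_le' hk1
        have hj1 : 1 ≤ j := by omega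
        have hjn : j ^ 2 ≤ n := by nlinarith
        have h1 := hmono (j ^ 2) n (Nat.one_le_pow _ _ hj1) hjn
        have h2 := hpos (j ^ 2) (Nat.one_le_pow _ _ hj1)
        push_cast at h1 h2
        have h3 := (div_lt_iff₀ h2).1 (hK j (by omega))
        exact h3.le.trans (by gcongr)
end

section
/- Let φ : ℝ⁺ → ℝ⁺ be an increasing function such that log φ is a regularly increasing function with index ρ, where 1/2 < ρ < 1. For n ≥ 1 set s_n = √φ(n) and t_n = √(φ(n)/n), and let B = {x ∈ (0,1) irrational : s_n − t_n < a_n(x) ≤ s_n + t_n for all n ≥ 1}. Then B ⊆ L(φ). -/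
open Filter Set
open scoped ENNReal

/-- A function whose logarithmic derivative has limiting index `ρ < 1` is sublinear. -/
lemma tendsto_div_id_of_index_lt_one {f f' : ℝ → ℝ} {c ρ : ℝ} (hρ : ρ < 1)
    (hpos : ∀ x ∈ Ici c, 0 < f x) (hder : ∀ x ∈ Ici c, HasDerivAt f (f' x) x)
    (hlim : Tendsto (fun x => x * f' x / f x) atTop (nhds ρ)) :
    Tendsto (fun x => f x / x) atTop (nhds 0) := by
  obtain ⟨r, hr, hr1⟩ := exists_between hρ
  obtain ⟨N, hN⟩ := eventually_atTop.1 (hlim.eventually_le_const hr)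
  set M := max (max N c) 1 with hM
  have hMN : N ≤ M := (le_max_left _ _).trans (le_max_left _ _)
  have hMc : c ≤ M := (le_max_right _ _).trans (le_max_left _ _)
  have hM1 : 1 ≤ M := le_max_right _ _
  have hg : ∀ x ∈ Ici M,
      HasDerivAt (fun y => Real.log (f y) - r * Real.log y) (f' x / f x - r * x⁻¹) x := by
    intro x hx
    have hx : M ≤ x := hx
    exact ((hder x (hMc.trans hx)).log (hpos x (hMc.trans hx)).ne').sub
      ((Real.hasDerivAt_log (by linarith)).const_mul r)
  have hanti : AntitoneOn (fun y => Real.log (f y) - r * Real.log y) (Ici M) := by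
    refine antitoneOn_of_deriv_nonpos (convex_Ici M)
      (fun x hx => (hg x hx).continuousAt.continuousWithinAt)
      (fun x hx => (hg x (interior_subset hx)).differentiableAt.differentiableWithinAt)
      fun x hx => ?_
    have hx : M ≤ x := interior_subset hx
    rw [(hg x hx).deriv]
    have hx0 : 0 < x := by linarith
    have h := hN x (hMN.trans hx)
    have h2 : f' x / f x = (x * f' x / f x) * x⁻¹ := by field_simp
    rw [h2, ← sub_mul]
    exact mul_nonpos_of_nonpos_of_nonneg (by linarith) (by positivity)
  set C := Real.log (f M) - r * Real.log M
  have hbound : Tendsto (fun x : ℝ => Real.exp C * x ^ (-(1 - r))) atTop (nhds 0) := by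
    simpa using (tendsto_rpow_neg_atTop (by linarith : 0 < 1 - r)).const_mul (Real.exp C)
  refine squeeze_zero' ?_ ?_ hbound
  · filter_upwards [eventually_ge_atTop M] with x hx
    exact div_nonneg (hpos x (hMc.trans hx)).le (by linarith)
  · filter_upwards [eventually_ge_atTop M] with x hx
    have hx0 : 0 < x := by linarith
    have h : Real.log (f x) - r * Real.log x ≤ C := hanti self_mem_Ici hx hx
    rw [Real.rpow_def_of_pos hx0, ← Real.exp_add, div_le_iff₀ hx0]
    nth_rw 3 [← Real.exp_log hx0]
    rw [← Real.exp_add, ← Real.log_le_iff_le_exp (hpos x (hMc.trans hx))]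
    linarith

/-- A function whose derivative tends to zero has increments over unit steps tending to zero. -/
lemma tendsto_sub_of_deriv_tendsto_zero {f f' : ℝ → ℝ} {c : ℝ}
    (hder : ∀ x ∈ Ici c, HasDerivAt f (f' x) x) (hlim : Tendsto f' atTop (nhds 0)) :
    Tendsto (fun x => f (x + 1) - f x) atTop (nhds 0) := by
  rw [Metric.tendsto_atTop] at hlim ⊢
  intro ε hε
  obtain ⟨N, hN⟩ := hlim ε hε
  refine ⟨max N c, fun x hx => ?_⟩
  have hxN : N ≤ x := (le_max_left _ _).trans hx
  have hxc : c ≤ x := (le_max_right _ _).trans hx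
  obtain ⟨y, hy, hyeq⟩ := exists_hasDerivAt_eq_slope f f' (lt_add_one x)
    (fun y hy => (hder y (hxc.trans hy.1)).continuousAt.continuousWithinAt)
    (fun y hy => hder y (hxc.trans hy.1.le))
  have h := hN y (hxN.trans hy.1.le)
  rwa [hyeq, add_sub_cancel_left, div_one] at h

/-- If `u` is asymptotic to a monotone sequence tending to infinity, so are its running maxima. -/
lemma tendsto_sup_Icc_div {u : ℕ → ℕ} {v : ℕ → ℝ} (hv : ∀ n, 1 ≤ n → 0 < v n)
    (hmono : ∀ i n, 1 ≤ i → i ≤ n → v i ≤ v n) (hinf : Tendsto v atTop atTop)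
    (huv : Tendsto (fun n => (u n : ℝ) / v n) atTop (nhds 1)) :
    Tendsto (fun n => (((Finset.Icc 1 n).sup u : ℕ) : ℝ) / v n) atTop (nhds 1) := by
  refine tendsto_order.2 ⟨fun a ha => ?_, fun b hb => ?_⟩
  · filter_upwards [huv.eventually_const_lt ha, eventually_ge_atTop 1] with n hn hn1
    refine hn.trans_le (div_le_div_of_nonneg_right ?_ (hv n hn1).le)
    exact_mod_cast Finset.le_sup (f := u) (Finset.mem_Icc.2 ⟨hn1, le_rfl⟩)
  · obtain ⟨N, hN⟩ := eventually_atTop.1 (huv.eventually_lt_const hb)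
    set K := (Finset.Icc 1 N).sup u
    filter_upwards [hinf.eventually_gt_atTop (K : ℝ), eventually_ge_atTop 1] with n hn hn1
    have hvn := hv n hn1
    rw [div_lt_iff₀ hvn]
    obtain ⟨i, hi, hieq⟩ := Finset.exists_mem_eq_sup (Finset.Icc 1 n) ⟨n, by simp [hn1]⟩ u
    rw [hieq]
    obtain ⟨hi1, hin⟩ := Finset.mem_Icc.1 hi
    rcases le_total i N with h | h
    · have hK : (u i : ℝ) ≤ K := by
        exact_mod_cast Finset.le_sup (f := u) (Finset.mem_Icc.2 ⟨hi1, h⟩)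
      nlinarith
    · have h2 := hN i h
      rw [div_lt_iff₀ (hv i hi1)] at h2
      have := hmono i n hi1 hin
      nlinarith

/-- Terms within `√(v n / n)` of `√(v n)` are asymptotic to `√(v n)`. -/
lemma tendsto_div_sqrt_of_near {a v : ℕ → ℝ} (hv : ∀ n, 1 ≤ n → 0 < v n)
    (ha : ∀ n : ℕ, 1 ≤ n → √(v n) - √(v n / n) < a n ∧ a n ≤ √(v n) + √(v n / n)) :
    Tendsto (fun n => a n / √(v n)) atTop (nhds 1) := by
  have h0 : Tendsto (fun n : ℕ => (√(n : ℝ))⁻¹) atTop (nhds 0) :=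
    (Real.tendsto_sqrt_atTop.comp tendsto_natCast_atTop_atTop).inv_tendsto_atTop
  refine tendsto_of_tendsto_of_tendsto_of_le_of_le'
    (by simpa using h0.const_sub 1) (by simpa using h0.const_add 1) ?_ ?_
  all_goals
    filter_upwards [eventually_ge_atTop 1] with n hn
    have hs : 0 < √(v n) := Real.sqrt_pos.2 (hv n hn)
    have h := ha n hn
    rw [Real.sqrt_div (hv n hn).le, div_eq_mul_inv (√(v n))] at h
    first
    | rw [le_div_iff₀ hs]; linarith [h.1]
    | rw [div_le_iff₀ hs]; linarith [h.2]

/-- Proposition 3.2: with `s_n = √φ(n)` and `t_n = √(φ(n)/n)`, the set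
`B = {x : s_n - t_n < a_n(x) ≤ s_n + t_n for all n ≥ 1}` is contained in `L(φ)`. -/
theorem statement7 (φ : ℝ → ℝ) (ρ : ℝ)
    (hφpos : ∀ x > (0 : ℝ), 0 < φ x)
    (hφmono : MonotoneOn φ (Ioi (0 : ℝ)))
    (hρ0 : 1 / 2 < ρ) (hρ : ρ < 1)
    (hreg : RegInc (fun x => Real.log (φ x)) ρ) :
    {x : ℝ | x ∈ Ioo (0 : ℝ) 1 ∧ Irrational x ∧
      ∀ n : ℕ, 1 ≤ n →
        (Real.sqrt (φ n) - Real.sqrt (φ n / n) < (pq x n : ℝ) ∧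
          (pq x n : ℝ) ≤ Real.sqrt (φ n) + Real.sqrt (φ n / n))}
      ⊆ Lset fun n : ℕ => φ n := by
  obtain ⟨c, -, f', hpos, hder, -, -, htop, hlim⟩ := hreg
  have hder0 : Tendsto f' atTop (nhds 0) := by
    have h := hlim.mul (tendsto_div_id_of_index_lt_one hρ hpos hder hlim)
    rw [mul_zero] at h
    refine h.congr' ?_
    filter_upwards [eventually_ge_atTop c, eventually_gt_atTop 0] with x hx hx0
    have := (hpos x hx).ne'
    field_simp
  have hv : ∀ n : ℕ, 1 ≤ n → 0 < φ n := fun n hn => hφpos n (by exact_mod_cast hn)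
  have hratio : Tendsto (fun n : ℕ => √(φ (n + 1 : ℕ)) / √(φ n)) atTop (nhds 1) := by
    have h := (tendsto_sub_of_deriv_tendsto_zero hder hder0).comp
      (tendsto_natCast_atTop_atTop (R := ℝ))
    have h2 := ((Real.continuous_exp.tendsto 0).comp h).sqrt
    rw [Real.exp_zero, Real.sqrt_one] at h2
    refine h2.congr' ?_
    filter_upwards [eventually_ge_atTop 1] with n hn
    have h1 := hv (n + 1) (by omega)
    rw [← Real.sqrt_div h1.le]
    push_cast at h1 ⊢
    simp only [Function.comp_apply]
    rw [Real.exp_sub, Real.exp_log h1, Real.exp_log (hv n hn)]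
  have hinf : Tendsto (fun n : ℕ => φ n) atTop atTop := by
    refine ((Real.tendsto_exp_atTop.comp htop).comp
      (tendsto_natCast_atTop_atTop (R := ℝ))).congr' ?_
    filter_upwards [eventually_ge_atTop 1] with n hn
    exact Real.exp_log (hv n hn)
  rintro x ⟨hx, hirr, ha⟩
  refine ⟨hx, hirr, tendsto_sup_Icc_div hv (fun i n hi hin => ?_) hinf ?_⟩
  · have hi' : (0 : ℝ) < i := by exact_mod_cast hi
    have hin' : (i : ℝ) ≤ n := by exact_mod_cast hin
    exact hφmono hi' (hi'.trans_le hin') hin'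
  · have hlim_a := tendsto_div_sqrt_of_near (a := fun n => (pq x n : ℝ))
      (v := fun n => φ n) hv ha
    have h := (hlim_a.mul (hlim_a.comp (tendsto_add_atTop_nat 1))).mul hratio
    rw [mul_one, mul_one] at h
    refine h.congr' ?_
    filter_upwards [eventually_ge_atTop 1] with n hn
    have h1 := Real.sqrt_pos.2 (hv n hn)
    have h2 := Real.sqrt_pos.2 (hv (n + 1) (by omega))
    simp only [Function.comp_apply, Nat.cast_mul]
    nth_rw 3 [← Real.mul_self_sqrt (hv n hn).le]
    field_simp
end

section
/- Let φ : ℝ⁺ → ℝ⁺ be an increasing function such that log φ is a regularly increasing function with index ρ, where 1/2 < ρ ≤ 1. Fix 0 < δ < ρ − 1/2, set γ = ρ − δ, and for k ≥ 1 set n_k = ⌊k^{1/γ}⌋. Then liminf_{k→∞} φ(n_k)/φ(n_{k−1}) > 1. -/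
open Filter Set
open scoped ENNReal

/-- If `γ g(x) ≤ x g'(x)` for `x ≥ X`, then `g(x) x^{-γ}` is nondecreasing on `[X, ∞)`. -/
lemma monotoneOn_mul_rpow_neg {g g' : ℝ → ℝ} {X γ : ℝ} (hX : 0 < X)
    (hg : ∀ x ∈ Ici X, HasDerivAt g (g' x) x) (hle : ∀ x ∈ Ici X, γ * g x ≤ x * g' x) :
    MonotoneOn (fun x => g x * x ^ (-γ)) (Ici X) := by
  have hd : ∀ x ∈ Ici X, HasDerivAt (fun x => g x * x ^ (-γ))
      (g' x * x ^ (-γ) + g x * (-γ * x ^ (-γ - 1))) x := fun x hx =>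
    (hg x hx).mul (Real.hasDerivAt_rpow_const (Or.inl (hX.trans_le hx).ne'))
  refine monotoneOn_of_hasDerivWithinAt_nonneg (convex_Ici X)
    (fun x hx => (hd x hx).continuousAt.continuousWithinAt)
    (fun x hx => (hd x (interior_subset hx)).hasDerivWithinAt) fun x hx => ?_
  have hx' : x ∈ Ici X := interior_subset hx
  have hx0 : 0 < x := hX.trans_le hx'
  have hp : x ^ (-γ) = x * x ^ (-γ - 1) := by
    rw [mul_comm, ← Real.rpow_add_one hx0.ne', sub_add_cancel]
  have hfac : g' x * x ^ (-γ) + g x * (-γ * x ^ (-γ - 1)) =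
      (x * g' x - γ * g x) * x ^ (-γ - 1) := by
    rw [hp]; ring
  rw [hfac]
  exact mul_nonneg (sub_nonneg.2 (hle x hx')) (Real.rpow_nonneg hx0.le _)

/-- If `g(x) x^{-γ}` is nondecreasing on `[X, ∞)`, the increments of `g` dominate those of
`C x^γ`, where `C = g(X) X^{-γ}`. -/
lemma mul_rpow_sub_rpow_le_sub {g : ℝ → ℝ} {X γ : ℝ} (hX : 0 < X) (hγ : 0 ≤ γ)
    (hmono : MonotoneOn (fun x => g x * x ^ (-γ)) (Ici X)) {x y : ℝ} (hx : X ≤ x) (hxy : x ≤ y) :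
    g X * X ^ (-γ) * (y ^ γ - x ^ γ) ≤ g y - g x := by
  have hy : X ≤ y := hx.trans hxy
  have hgx : ∀ z, X ≤ z → g z = g z * z ^ (-γ) * z ^ γ := fun z hz => by
    rw [mul_assoc, ← Real.rpow_add (hX.trans_le hz), neg_add_cancel, Real.rpow_zero, mul_one]
  have hXx : g X * X ^ (-γ) ≤ g x * x ^ (-γ) := hmono self_mem_Ici hx hx
  have hxy' : g x * x ^ (-γ) ≤ g y * y ^ (-γ) := hmono hx hy hxy
  have hpow : x ^ γ ≤ y ^ γ := Real.rpow_le_rpow (hX.le.trans hx) hxy hγ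
  calc g X * X ^ (-γ) * (y ^ γ - x ^ γ)
      ≤ g x * x ^ (-γ) * (y ^ γ - x ^ γ) := by gcongr
    _ = g x * x ^ (-γ) * y ^ γ - g x := by rw [mul_sub, ← hgx x hx]
    _ ≤ g y * y ^ (-γ) * y ^ γ - g x := by
        gcongr; exact Real.rpow_nonneg (hX.le.trans hy) _
    _ = g y - g x := by rw [← hgx y hy]

lemma floor_rpow_inv_rpow_le {γ t : ℝ} (hγ : 0 < γ) (ht : 0 ≤ t) :
    (⌊t ^ (1 / γ)⌋₊ : ℝ) ^ γ ≤ t := by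
  calc (⌊t ^ (1 / γ)⌋₊ : ℝ) ^ γ ≤ (t ^ (1 / γ)) ^ γ := by
        gcongr; exact Nat.floor_le (by positivity)
    _ = t := by rw [← Real.rpow_mul ht, one_div_mul_cancel hγ.ne', Real.rpow_one]

lemma sub_rpow_le_floor_rpow_inv_rpow {γ t : ℝ} (hγ : 0 < γ) (hγ1 : γ ≤ 1) (ht : 1 ≤ t) :
    t - t ^ (1 - 1 / γ) ≤ (⌊t ^ (1 / γ)⌋₊ : ℝ) ^ γ := by
  have ht0 : 0 < t := one_pos.trans_le ht
  set s := t ^ (1 / γ) with hs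
  have hs1 : 1 ≤ s := Real.one_le_rpow ht (by positivity)
  have hs0 : 0 < s := one_pos.trans_le hs1
  have hsγ : s ^ γ = t := by
    rw [hs, ← Real.rpow_mul ht0.le, one_div_mul_cancel hγ.ne', Real.rpow_one]
  have hb0 : 0 ≤ 1 - s⁻¹ := sub_nonneg.2 (inv_le_one_of_one_le₀ hs1)
  have hb1 : 1 - s⁻¹ ≤ 1 := sub_le_self _ (inv_nonneg.2 hs0.le)
  calc t - t ^ (1 - 1 / γ) = t * (1 - s⁻¹) := by
        rw [Real.rpow_sub ht0, Real.rpow_one, ← hs]; ring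
    _ ≤ t * (1 - s⁻¹) ^ γ := by
        gcongr; exact Real.self_le_rpow_of_le_one hb0 hb1 hγ1
    _ = (s - 1) ^ γ := by
        rw [← hsγ, ← Real.mul_rpow hs0.le hb0, mul_sub, mul_one, mul_inv_cancel₀ hs0.ne']
    _ ≤ (⌊s⌋₊ : ℝ) ^ γ :=
        Real.rpow_le_rpow (sub_nonneg.2 hs1) (Nat.sub_one_lt_floor s).le hγ.le

/-- For `0 < γ < 1` and `n_k = ⌊k^{1/γ}⌋`, eventually `n_k^γ - n_{k-1}^γ ≥ 1/2`. -/
lemma eventually_half_le_floor_rpow_sub {γ : ℝ} (hγ : 0 < γ) (hγ1 : γ < 1) :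
    ∀ᶠ k : ℕ in atTop, 1 / 2 ≤ (⌊(k : ℝ) ^ (1 / γ)⌋₊ : ℝ) ^ γ -
      (⌊((k - 1 : ℕ) : ℝ) ^ (1 / γ)⌋₊ : ℝ) ^ γ := by
  have hexp : 0 < 1 / γ - 1 := sub_pos.2 (one_lt_one_div hγ hγ1)
  have hlim : Tendsto (fun k : ℕ => (k : ℝ) ^ (1 - 1 / γ)) atTop (nhds 0) := by
    simpa [Function.comp_def] using
      (tendsto_rpow_neg_atTop hexp).comp tendsto_natCast_atTop_atTop
  filter_upwards [hlim.eventually_le_const (by norm_num : (0 : ℝ) < 1 / 2),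
    eventually_ge_atTop 1] with k hk hk1
  have hlow := sub_rpow_le_floor_rpow_inv_rpow hγ hγ1.le (by exact_mod_cast hk1 : (1 : ℝ) ≤ k)
  have hup := floor_rpow_inv_rpow_le hγ (Nat.cast_nonneg (α := ℝ) (k - 1))
  rw [Nat.cast_sub hk1, Nat.cast_one] at hup ⊢
  linarith

/-- Proposition 3.5: with `γ = ρ - δ` and `n_k = ⌊k^{1/γ}⌋`,
`liminf_k φ(n_k)/φ(n_{k-1}) > 1`. -/
theorem statement8 (φ : ℝ → ℝ) (ρ : ℝ)
    (hφpos : ∀ x > (0 : ℝ), 0 < φ x)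
    (hφmono : MonotoneOn φ (Ioi (0 : ℝ)))
    (hρ0 : 1 / 2 < ρ) (hρ : ρ ≤ 1)
    (hreg : RegInc (fun x => Real.log (φ x)) ρ)
    (δ : ℝ) (hδ0 : 0 < δ) (hδ : δ < ρ - 1 / 2) :
    1 < Filter.liminf (fun k : ℕ =>
      ENNReal.ofReal (φ (⌊(k : ℝ) ^ (1 / (ρ - δ))⌋₊ : ℕ) /
        φ (⌊((k - 1 : ℕ) : ℝ) ^ (1 / (ρ - δ))⌋₊ : ℕ))) atTop := by
  obtain ⟨c, hc, g', hgpos, hgderiv, -, -, -, hglim⟩ := hreg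
  have hγ : 0 < ρ - δ := by linarith
  have hγ1 : ρ - δ < 1 := by linarith
  have hγρ : ρ - δ < ρ := by linarith
  generalize ρ - δ = γ at *
  obtain ⟨X, hcX, hX⟩ : ∃ X ≥ c, ∀ x ≥ X, γ ≤ x * g' x / Real.log (φ x) := by
    obtain ⟨Y, hY⟩ := eventually_atTop.1 (hglim.eventually_const_le hγρ)
    exact ⟨max c Y, le_max_left _ _, fun x hx => hY x ((le_max_right _ _).trans hx)⟩
  have hX0 : 0 < X := hc.trans_le hcX
  have hmono : MonotoneOn (fun x => Real.log (φ x) * x ^ (-γ)) (Ici X) :=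
    monotoneOn_mul_rpow_neg hX0 (fun x hx => hgderiv x (hcX.trans hx)) fun x hx =>
      (le_div_iff₀ (hgpos x (hcX.trans hx))).1 (hX x hx)
  set C := Real.log (φ X) * X ^ (-γ)
  have hC : 0 < C := mul_pos (hgpos X hcX) (Real.rpow_pos_of_pos hX0 _)
  have hγinv : 0 < 1 / γ := by positivity
  have hn : Tendsto (fun k : ℕ => (⌊((k - 1 : ℕ) : ℝ) ^ (1 / γ)⌋₊ : ℝ)) atTop atTop :=
    tendsto_natCast_atTop_atTop.comp <| tendsto_nat_floor_atTop.comp <|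
      (tendsto_rpow_atTop hγinv).comp <| tendsto_natCast_atTop_atTop.comp <|
        tendsto_sub_atTop_nat 1
  have hlt : 1 < ENNReal.ofReal (Real.exp (C * (1 / 2))) := by
    rw [ENNReal.one_lt_ofReal, Real.one_lt_exp_iff]
    positivity
  refine hlt.trans_le (le_liminf_of_le (by isBoundedDefault) ?_)
  filter_upwards [hn.eventually_ge_atTop X, eventually_half_le_floor_rpow_sub hγ hγ1]
    with k hkX hk
  have hle : (⌊((k - 1 : ℕ) : ℝ) ^ (1 / γ)⌋₊ : ℝ) ≤ ⌊(k : ℝ) ^ (1 / γ)⌋₊ := by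
    gcongr
    exact Nat.sub_le k 1
  have hinc := mul_rpow_sub_rpow_le_sub hX0 hγ.le hmono hkX hle
  have hx0 := hφpos _ (hX0.trans_le hkX)
  have hy0 := hφpos _ (hX0.trans_le (hkX.trans hle))
  apply ENNReal.ofReal_le_ofReal
  rw [← Real.le_log_iff_exp_le (div_pos hy0 hx0), Real.log_div hy0.ne' hx0.ne']
  exact (mul_le_mul_of_nonneg_left hk hC.le).trans hinc
end

section
/- Let φ : ℝ⁺ → ℝ⁺ be an increasing function such that log φ is a regularly increasing function with index ρ, where 1/2 < ρ ≤ 1. Fix 0 < δ < ρ − 1/2, set γ = ρ − δ, and for k ≥ 1 set n_k = ⌊k^{1/γ}⌋. Let x ∈ L(φ). Then for all sufficiently large k ∈ ℕ there exists an integer j_k with n_{k−1} < j_k ≤ n_k such that L_{n_k}(x) = a_{j_k}(x)·a_{j_k+1}(x). -/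
open Filter Set
open scoped ENNReal

/-- If `x f'(x) ≥ γ f(x)` on `[M, ∞)`, then `f(x) x^{-γ}` is nondecreasing there. -/
theorem monotoneOn_mul_rpow_neg_s9 {f f' : ℝ → ℝ} {γ M : ℝ} (hM : 0 < M)
    (hd : ∀ x ∈ Ici M, HasDerivAt f (f' x) x) (hf : ∀ x ∈ Ici M, γ * f x ≤ x * f' x) :
    MonotoneOn (fun x => f x * x ^ (-γ)) (Ici M) := by
  have hder : ∀ x ∈ Ici M, HasDerivAt (fun x => f x * x ^ (-γ))
      (f' x * x ^ (-γ) + f x * (-γ * x ^ (-γ - 1))) x := fun x hx =>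
    (hd x hx).mul (Real.hasDerivAt_rpow_const (Or.inl (hM.trans_le hx).ne'))
  refine monotoneOn_of_deriv_nonneg (convex_Ici M)
    (fun x hx => (hder x hx).continuousAt.continuousWithinAt)
    (fun x hx => (hder x (interior_subset hx)).differentiableAt.differentiableWithinAt) ?_
  intro x hx
  have hxM : x ∈ Ici M := interior_subset hx
  have hx0 : 0 < x := hM.trans_le hxM
  rw [(hder x hxM).deriv]
  have hpow : x ^ (-γ) = x * x ^ (-γ - 1) := by
    rw [Real.rpow_sub_one hx0.ne']
    field_simp
  have hpos : 0 < x ^ (-γ - 1) := Real.rpow_pos_of_pos hx0 _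
  have := mul_nonneg (sub_nonneg.2 (hf x hxM)) hpos.le
  rw [hpow]
  linarith

/-- If the logarithmic index of `f` is eventually at least `γ`, the increments of `f` dominate
a positive multiple of those of `x ↦ x ^ γ`. -/
theorem RegInc.exists_mul_rpow_sub_le {f : ℝ → ℝ} {ρ γ : ℝ} (hf : RegInc f ρ) (hγ : 0 < γ)
    (hγρ : γ < ρ) :
    ∃ C > 0, ∃ M > 0, ∀ x y, M ≤ x → x ≤ y → C * (y ^ γ - x ^ γ) ≤ f y - f x := by
  obtain ⟨c, hc, f', hpos, hd, -, -, -, hlim⟩ := hf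
  obtain ⟨N, hN⟩ := eventually_atTop.1 (hlim.eventually_const_lt hγρ)
  set M := max c N
  have hcM : c ≤ M := le_max_left _ _
  have hM : 0 < M := hc.trans_le hcM
  have hmono := monotoneOn_mul_rpow_neg_s9 (γ := γ) hM (fun x hx => hd x (hcM.trans hx))
    fun x hx => ((lt_div_iff₀ (hpos x (hcM.trans hx))).1 (hN x ((le_max_right _ _).trans hx))).le
  refine ⟨f M * M ^ (-γ), mul_pos (hpos M hcM) (Real.rpow_pos_of_pos hM _), M, hM, ?_⟩
  intro x y hx hxy
  have hx0 := hM.trans_le hx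
  have hy0 := hx0.trans_le hxy
  have cancel : ∀ z : ℝ, 0 < z → f z = f z * z ^ (-γ) * z ^ γ := fun z hz => by
    rw [mul_assoc, ← Real.rpow_add hz, neg_add_cancel, Real.rpow_zero, mul_one]
  have h1 : f M * M ^ (-γ) ≤ f x * x ^ (-γ) := hmono self_mem_Ici hx hx
  have h2 : f x * x ^ (-γ) ≤ f y * y ^ (-γ) := hmono hx (hx.trans hxy) hxy
  have h3 : x ^ γ ≤ y ^ γ := Real.rpow_le_rpow hx0.le hxy hγ.le
  calc f M * M ^ (-γ) * (y ^ γ - x ^ γ)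
      ≤ f x * x ^ (-γ) * (y ^ γ - x ^ γ) := mul_le_mul_of_nonneg_right h1 (sub_nonneg.2 h3)
    _ = f x * x ^ (-γ) * y ^ γ - f x := by rw [mul_sub, ← cancel x hx0]
    _ ≤ f y * y ^ (-γ) * y ^ γ - f x :=
        sub_le_sub_right (mul_le_mul_of_nonneg_right h2 (Real.rpow_nonneg hy0.le _)) _
    _ = f y - f x := by rw [← cancel y hy0]

/-- For `0 < γ < 1`, the `γ`-th powers of `⌊k^{1/γ}⌋` have gaps eventually at least `1/2`. -/
theorem eventually_half_le_floor_rpow_gap {γ : ℝ} (hγ : 0 < γ) (hγ1 : γ < 1) :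
    ∀ᶠ k : ℕ in atTop, (1 / 2 : ℝ) ≤ (⌊(k : ℝ) ^ (1 / γ)⌋₊ : ℝ) ^ γ -
      (⌊((k - 1 : ℕ) : ℝ) ^ (1 / γ)⌋₊ : ℝ) ^ γ := by
  have hlim : Tendsto (fun k : ℕ => (k : ℝ) ^ (-(1 / γ - 1))) atTop (nhds 0) :=
    (tendsto_rpow_neg_atTop (sub_pos.2 ((one_lt_div hγ).2 hγ1))).comp tendsto_natCast_atTop_atTop
  filter_upwards [hlim.eventually_lt_const (show (0 : ℝ) < 1 / 2 by norm_num),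
    eventually_ge_atTop 1] with k hk hk1
  have hkR : (1 : ℝ) ≤ k := by exact_mod_cast hk1
  have hk0 : (0 : ℝ) < k := by linarith
  have hinv : ∀ z : ℝ, 0 ≤ z → (z ^ (1 / γ)) ^ γ = z := fun z hz => by
    rw [← Real.rpow_mul hz, one_div_mul_cancel hγ.ne', Real.rpow_one]
  have hupper : (⌊((k - 1 : ℕ) : ℝ) ^ (1 / γ)⌋₊ : ℝ) ^ γ ≤ k - 1 := by
    calc (⌊((k - 1 : ℕ) : ℝ) ^ (1 / γ)⌋₊ : ℝ) ^ γ
        ≤ (((k - 1 : ℕ) : ℝ) ^ (1 / γ)) ^ γ :=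
          Real.rpow_le_rpow (Nat.cast_nonneg _) (Nat.floor_le (by positivity)) hγ.le
      _ = k - 1 := by rw [hinv _ (Nat.cast_nonneg _), Nat.cast_pred hk1]
  set t := (k : ℝ) ^ (1 / γ)
  have ht1 : 1 ≤ t := Real.one_le_rpow hkR (by positivity)
  have ht0 : 0 < t := by linarith
  have hu0 : 0 ≤ 1 - t⁻¹ := sub_nonneg.2 (inv_le_one_of_one_le₀ ht1)
  have hu1 : 1 - t⁻¹ ≤ 1 := sub_le_self _ (by positivity)
  have hsmall : (k : ℝ) * t⁻¹ = (k : ℝ) ^ (-(1 / γ - 1)) := by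
    rw [neg_sub, Real.rpow_sub hk0, Real.rpow_one, div_eq_mul_inv]
  have hlower : (k : ℝ) - 1 / 2 ≤ (⌊t⌋₊ : ℝ) ^ γ := by
    calc (k : ℝ) - 1 / 2 ≤ k * (1 - t⁻¹) := by rw [mul_sub, mul_one, hsmall]; linarith
      _ ≤ k * (1 - t⁻¹) ^ γ := by
          gcongr
          simpa using Real.rpow_le_rpow_of_exponent_ge' hu0 hu1 hγ.le hγ1.le
      _ = (t * (1 - t⁻¹)) ^ γ := by rw [Real.mul_rpow ht0.le hu0, hinv _ hk0.le]
      _ ≤ (⌊t⌋₊ : ℝ) ^ γ := by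
          refine Real.rpow_le_rpow (mul_nonneg ht0.le hu0) ?_ hγ.le
          rw [mul_sub, mul_one, mul_inv_cancel₀ ht0.ne']
          linarith [Nat.lt_floor_add_one t]
  linarith

/-- If `L_m(x) < L_n(x)`, then `L_n(x)` is attained at an index in `(m, n]`. -/
theorem exists_eq_pq_mul_of_Lmax_lt {x : ℝ} {m n : ℕ} (h : Lmax x m < Lmax x n) :
    ∃ j, m < j ∧ j ≤ n ∧ Lmax x n = pq x j * pq x (j + 1) := by
  have hne : (Finset.Icc 1 n).Nonempty := by
    by_contra hemp
    rw [Finset.not_nonempty_iff_eq_empty] at hemp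
    simp [Lmax, hemp] at h
  obtain ⟨j, hj, hjeq⟩ := Finset.exists_mem_eq_sup _ hne fun i => pq x i * pq x (i + 1)
  rw [Finset.mem_Icc] at hj
  refine ⟨j, ?_, hj.2, hjeq⟩
  by_contra! hjm
  refine h.not_ge (hjeq.trans_le ?_)
  exact Finset.le_sup (f := fun i => pq x i * pq x (i + 1)) (Finset.mem_Icc.2 ⟨hj.1, hjm⟩)

/-- Proposition 3.6: for `x ∈ L(φ)` and `n_k = ⌊k^{1/(ρ-δ)}⌋`, for all large `k` the
maximum `L_{n_k}(x)` is attained at some index `j_k` with `n_{k-1} < j_k ≤ n_k`. -/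
theorem statement9 (φ : ℝ → ℝ) (ρ : ℝ)
    (hφpos : ∀ x > (0 : ℝ), 0 < φ x)
    (hφmono : MonotoneOn φ (Ioi (0 : ℝ)))
    (hρ0 : 1 / 2 < ρ) (hρ : ρ ≤ 1)
    (hreg : RegInc (fun x => Real.log (φ x)) ρ)
    (δ : ℝ) (hδ0 : 0 < δ) (hδ : δ < ρ - 1 / 2)
    (x : ℝ) (hx : x ∈ Lset fun n : ℕ => φ n) :
    ∀ᶠ k : ℕ in atTop, ∃ j : ℕ,
      ⌊((k - 1 : ℕ) : ℝ) ^ (1 / (ρ - δ))⌋₊ < j ∧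
      j ≤ ⌊(k : ℝ) ^ (1 / (ρ - δ))⌋₊ ∧
      Lmax x ⌊(k : ℝ) ^ (1 / (ρ - δ))⌋₊ = pq x j * pq x (j + 1) := by
  have hγ : 0 < ρ - δ := by linarith
  obtain ⟨C, hC, M, hM, hinc⟩ := hreg.exists_mul_rpow_sub_le hγ (sub_lt_self ρ hδ0)
  have hgap := eventually_half_le_floor_rpow_gap hγ (by linarith : ρ - δ < 1)
  have hn : Tendsto (fun k : ℕ => ⌊(k : ℝ) ^ (1 / (ρ - δ))⌋₊) atTop atTop :=
    tendsto_nat_floor_atTop.comp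
      ((tendsto_rpow_atTop (one_div_pos.2 hγ)).comp tendsto_natCast_atTop_atTop)
  have hn' : Tendsto (fun k : ℕ => ⌊((k - 1 : ℕ) : ℝ) ^ (1 / (ρ - δ))⌋₊) atTop atTop :=
    hn.comp (tendsto_sub_atTop_nat 1)
  have hlt := (hx.2.2.comp hn').eventually_lt ((hx.2.2.comp hn).const_mul (Real.exp (C * (1 / 2))))
    (by rw [mul_one]; exact Real.one_lt_exp_iff.2 (by positivity))
  filter_upwards [hgap, hlt, (tendsto_natCast_atTop_atTop.comp hn').eventually_ge_atTop M]
    with k hgap hlt hM'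
  simp only [Function.comp_apply] at hlt hM'
  refine exists_eq_pq_mul_of_Lmax_lt ?_
  set m := ⌊((k - 1 : ℕ) : ℝ) ^ (1 / (ρ - δ))⌋₊
  set n := ⌊(k : ℝ) ^ (1 / (ρ - δ))⌋₊
  have hm0 : (0 : ℝ) < m := hM.trans_le hM'
  have hmn : (m : ℝ) ≤ n := by
    refine (Real.rpow_le_rpow_iff hm0.le (Nat.cast_nonneg n) hγ).1 ?_
    linarith
  have hφm := hφpos m hm0
  have hφn := hφpos n (hm0.trans_le hmn)
  have hexp : Real.exp (C * (1 / 2)) * φ m ≤ φ n := by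
    have hlog : C * (1 / 2) + Real.log (φ m) ≤ Real.log (φ n) := by
      linarith [hinc m n hM' hmn, mul_le_mul_of_nonneg_left hgap hC.le]
    simpa [Real.exp_add, Real.exp_log hφm, Real.exp_log hφn] using Real.exp_le_exp.2 hlog
  rw [div_lt_iff₀ hφm] at hlt
  have hbound : Real.exp (C * (1 / 2)) * ((Lmax x n : ℝ) / φ n) * φ m ≤ Lmax x n := by
    calc Real.exp (C * (1 / 2)) * ((Lmax x n : ℝ) / φ n) * φ m
        = Real.exp (C * (1 / 2)) * φ m * ((Lmax x n : ℝ) / φ n) := by ring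
      _ ≤ φ n * ((Lmax x n : ℝ) / φ n) := by gcongr
      _ = Lmax x n := mul_div_cancel₀ _ hφn.ne'
  exact_mod_cast hlt.trans_le hbound
end

section
/- Let α ∈ (0,∞), let φ(n) = e^{αn}, and for N ∈ ℕ let Υ(α,N) = {x ∈ (0,1) irrational : e^{−α/4} < a_n(x)/e^{αn/2} < e^{−α/4} + 1/n for all n ≥ N}. Then Υ(α,N) ⊆ L(φ). -/
open Filter Set
open scoped ENNReal

/-- If `p n ∼ φ n` with `φ` monotone and tending to infinity, then the running maxima of `p`
are also asymptotic to `φ`. -/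
theorem tendsto_sup_Icc_div_s10 {p : ℕ → ℕ} {φ : ℕ → ℝ} (hmono : Monotone φ)
    (htop : Tendsto φ atTop atTop) (hp : Tendsto (fun n => (p n : ℝ) / φ n) atTop (nhds 1)) :
    Tendsto (fun n => (((Finset.Icc 1 n).sup p : ℕ) : ℝ) / φ n) atTop (nhds 1) := by
  refine tendsto_order.2 ⟨fun b hb => ?_, fun b hb => ?_⟩
  · filter_upwards [hp.eventually_const_lt hb, htop.eventually_gt_atTop 0,
      eventually_ge_atTop 1] with n hn hpos h1
    have hle : p n ≤ (Finset.Icc 1 n).sup p := Finset.le_sup (Finset.mem_Icc.2 ⟨h1, le_rfl⟩)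
    exact hn.trans_le (by gcongr)
  · have hev := (hp.eventually_lt_const hb).and (htop.eventually_gt_atTop 0)
    obtain ⟨M, hM⟩ := eventually_atTop.1 hev
    filter_upwards [htop.eventually_gt_atTop (((Finset.Icc 1 M).sup p : ℕ) : ℝ),
      htop.eventually_gt_atTop 0] with n hC hpos
    rw [div_lt_iff₀ hpos]
    have hbn : 0 < b * φ n := by positivity
    obtain hS | hS := (Finset.Icc 1 n).eq_empty_or_nonempty
    · simpa [hS] using hbn
    obtain ⟨i, hi, hsup⟩ := Finset.exists_mem_eq_sup _ hS p
    rw [hsup]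
    rw [Finset.mem_Icc] at hi
    obtain hiM | hiM := le_total i M
    · have hle : p i ≤ (Finset.Icc 1 M).sup p := Finset.le_sup (Finset.mem_Icc.2 ⟨hi.1, hiM⟩)
      have hle' : (p i : ℝ) ≤ (((Finset.Icc 1 M).sup p : ℕ) : ℝ) := by exact_mod_cast hle
      nlinarith
    · obtain ⟨h1, h2⟩ := hM i hiM
      rw [div_lt_iff₀ h2] at h1
      exact h1.trans_le (mul_le_mul_of_nonneg_left (hmono hi.2) (by linarith))

/-- Step 1 for the case `ρ = 1`: the set `Υ(α, N)` is contained in `L(φ)`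
for `φ(n) = e^{αn}`. -/
theorem statement10 (α : ℝ) (hα : 0 < α) (N : ℕ) (hN : 1 ≤ N) :
    {x : ℝ | x ∈ Ioo (0 : ℝ) 1 ∧ Irrational x ∧
      ∀ n : ℕ, N ≤ n →
        (Real.exp (-(α / 4)) < (pq x n : ℝ) / Real.exp (α * n / 2) ∧
          (pq x n : ℝ) / Real.exp (α * n / 2) < Real.exp (-(α / 4)) + 1 / n)}
      ⊆ Lset fun n : ℕ => Real.exp (α * n) := by
  rintro x ⟨hx, hirr, h⟩
  refine ⟨hx, hirr, tendsto_sup_Icc_div_s10 (p := fun i => pq x i * pq x (i + 1)) ?_ ?_ ?_⟩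
  · intro m n hmn
    dsimp only
    gcongr
  · exact Real.tendsto_exp_atTop.comp (tendsto_natCast_atTop_atTop.const_mul_atTop hα)
  · have hu : Tendsto (fun n : ℕ => (pq x n : ℝ) / Real.exp (α * n / 2)) atTop
        (nhds (Real.exp (-(α / 4)))) := by
      refine tendsto_of_tendsto_of_tendsto_of_le_of_le' tendsto_const_nhds
        (h := fun n : ℕ => Real.exp (-(α / 4)) + 1 / (n : ℝ)) ?_ ?_ ?_
      · simpa using tendsto_one_div_atTop_nhds_zero_nat (𝕜 := ℝ) |>.const_add
          (Real.exp (-(α / 4)))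
      · filter_upwards [eventually_ge_atTop N] with n hn using (h n hn).1.le
      · filter_upwards [eventually_ge_atTop N] with n hn using (h n hn).2.le
    have hprod := (hu.mul (hu.comp (tendsto_add_atTop_nat 1))).mul_const (Real.exp (α / 2))
    have hlim : Real.exp (-(α / 4)) * Real.exp (-(α / 4)) * Real.exp (α / 2) = 1 := by
      rw [← Real.exp_add, ← Real.exp_add, Real.exp_eq_one_iff]
      ring
    rw [hlim] at hprod
    refine hprod.congr fun n => ?_
    have hexp : Real.exp (α * n / 2) * Real.exp (α * (n + 1 : ℕ) / 2) =
        Real.exp (α * n) * Real.exp (α / 2) := by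
      rw [← Real.exp_add, ← Real.exp_add]
      push_cast
      ring_nf
    simp only [Function.comp_apply]
    rw [div_mul_div_comm, hexp, Nat.cast_mul]
    field_simp
end
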